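/- arXiv:1806.03638 — 2 statements merged into one kernel-verified Lean document; each statement's English description precedes it below -/
import Mathlib

section
/- Pseudo-addition identity for the Loewner kernel: for every r > 0 and all z, w ∈ ℂ with z, w, z−w ∉ L_r, one has H(r,z−w)·(H(r,z) − H(r,w)) = (1/2)·H(r,z−w)² + (1/2)·(H(r,z) − H(r,w))² + H′(r,z−w) + H′(r,z) + H′(r,w) + (6/π)·ζ_r(π), where H′ denotes the derivative of H(r,·) in its second variable. -/
open Complex

/-- The theta function Θ(r,z) = (1/i)·∑_{n∈ℤ} (−1)^n e^{−r(n+1/2)²} e^{(n+1/2)iz}. -/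
noncomputable def Theta (r : ℝ) (z : ℂ) : ℂ :=
  (1 / Complex.I) * ∑' n : ℤ, (-1 : ℂ) ^ n *
    Complex.exp (-(r : ℂ) * ((n : ℂ) + 1 / 2) ^ 2) *
    Complex.exp (((n : ℂ) + 1 / 2) * Complex.I * z)

/-- The Loewner kernel H(r,z) = 2 Θ′(r,z)/Θ(r,z). -/
noncomputable def Hker (r : ℝ) (z : ℂ) : ℂ := 2 * deriv (Theta r) z / Theta r z

/-- The lattice L_r = 2πℤ + 2irℤ. -/
def ThetaLattice (r : ℝ) : Set ℂ :=
  {z | ∃ m n : ℤ, z = 2 * (Real.pi : ℂ) * m + 2 * Complex.I * r * n}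

/-- Lattice point 2πm + 2irn. -/
noncomputable def latPt (r : ℝ) (p : ℤ × ℤ) : ℂ :=
  2 * (Real.pi : ℂ) * p.1 + 2 * Complex.I * (r : ℂ) * p.2

/-- The Weierstrass zeta function with periods (2π, 2ir). -/
noncomputable def wzeta (r : ℝ) (z : ℂ) : ℂ :=
  1 / z + ∑' p : ℤ × ℤ, if p = 0 then 0 else
    (1 / (z - latPt r p) + 1 / latPt r p + z / latPt r p ^ 2)

open Filter Topology in
/-- Liouville theorem for functions with removable singularities that are doubly periodic. -/
lemma liouville_periodic (L : PeriodPair) (f : ℂ → ℂ)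
    (hper : ∀ l ∈ L.lattice, ∀ x, ∀ᶠ y in 𝓝[≠] x, f (y + l) = f y)
    (han : ∀ x, ∀ᶠ y in 𝓝[≠] x, DifferentiableAt ℂ f y)
    (hlim : ∀ x, ∃ l ∈ L.lattice, ∃ c, Tendsto f (𝓝[≠] (x + l)) (𝓝 c)) :
    ∃ c, ∀ x, Tendsto f (𝓝[≠] x) (𝓝 c) := by
  have hsh : ∀ z w : ℂ, Tendsto (fun y => y + w) (𝓝[≠] z) (𝓝[≠] (z + w)) := by
    intro z w
    refine tendsto_nhdsWithin_iff.2 ⟨?_, ?_⟩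
    · exact (Continuous.tendsto (by fun_prop) z).mono_left nhdsWithin_le_nhds
    · filter_upwards [self_mem_nhdsWithin] with y hy
      simpa using hy
  replace hlim : ∀ x, ∃ l, Tendsto f (𝓝[≠] x) (𝓝 l) := by
    intro x
    obtain ⟨l, hl, c, hc⟩ := hlim x
    exact ⟨c, (hc.comp (hsh x l)).congr' (hper l hl x)⟩
  choose g hg using hlim
  have hgf : ∀ x, DifferentiableAt ℂ f x → g x = f x := fun x hx =>
    tendsto_nhds_unique (hg x) (hx.continuousAt.tendsto.mono_left nhdsWithin_le_nhds)
  have hd : Differentiable ℂ g := by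
    intro x
    have h1 := han x
    rw [← eventually_eventually_nhdsWithin] at h1
    have h2 : ∀ᶠ y in 𝓝[≠] x, DifferentiableAt ℂ g y := by
      filter_upwards [h1, self_mem_nhdsWithin] with y hy hyx
      have hy' : ∀ᶠ t in 𝓝 y, DifferentiableAt ℂ f t := by
        rwa [IsOpen.nhdsWithin_eq isOpen_compl_singleton hyx] at hy
      have : g =ᶠ[𝓝 y] f := hy'.mono fun t ht => hgf t ht
      exact (this.differentiableAt_iff).2 hy'.self_of_nhds
    have h3 : ContinuousAt g x := by
      rw [← continuousWithinAt_compl_self]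
      refine (hg x).congr' ?_
      filter_upwards [han x] with y hy using (hgf y hy).symm
    exact (Complex.analyticAt_of_differentiable_on_punctured_nhds_of_continuousAt h2
      h3).differentiableAt
  have hp : ∀ z, ∀ w ∈ L.lattice, g (z + w) = g z := by
    intro z w hw
    have h2 := (hg (z + w)).comp (hsh z w)
    exact tendsto_nhds_unique (h2.congr' (hper w hw z)) (hg z)
  refine ⟨g 0, fun x => ?_⟩
  rw [← hd.apply_eq_apply_of_bounded (IsZLattice.isCompact_range_of_periodic L.lattice _
    hd.continuous hp).isBounded x 0]
  exact hg x

/-- The period pair `(2π, 2ir)`. -/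
noncomputable def PP (r : ℝ) (hr : 0 < r) : PeriodPair where
  ω₁ := 2 * (Real.pi : ℂ)
  ω₂ := 2 * Complex.I * (r : ℂ)
  indep := by
    rw [LinearIndependent.pair_iff]
    intro s t h
    have h1 := congrArg Complex.re h
    have h2 := congrArg Complex.im h
    simp [Real.pi_ne_zero, hr.ne'] at h1 h2
    exact ⟨h1, h2⟩

lemma mem_PP (r : ℝ) (hr : 0 < r) (z : ℂ) : z ∈ (PP r hr).lattice ↔ z ∈ ThetaLattice r := by
  rw [PeriodPair.mem_lattice]
  simp only [ThetaLattice, Set.mem_ofPred_eq, PP]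
  constructor
  · rintro ⟨m, n, h⟩
    exact ⟨m, n, by rw [← h]; ring⟩
  · rintro ⟨m, n, h⟩
    exact ⟨m, n, by rw [h]; ring⟩

open Filter Topology in
lemma eventually_notMem (L : PeriodPair) (x : ℂ) : ∀ᶠ y in 𝓝[≠] x, y ∉ L.lattice := by
  have := L.compl_lattice_sdiff_singleton_mem_nhds x
  filter_upwards [mem_nhdsWithin_of_mem_nhds this, self_mem_nhdsWithin] with y hy hyx
  simp at hy hyx
  tauto

/-! ### The Weierstrass zeta function -/

section zeta
open Filter Topology PeriodPair

lemma zeta_bound (L : PeriodPair) (z : ℂ) :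
    Summable (fun l : L.lattice => 1 / (z - l) + 1 / (l : ℂ) + z / (l : ℂ) ^ 2) := by
  have hs : Summable (fun l : L.lattice => 2 * ‖z‖ ^ 2 * ‖(l : L.lattice)‖ ^ (-3 : ℝ)) :=
    (ZLattice.summable_norm_rpow _ _ (by simp; norm_num)).mul_left _
  refine Summable.of_norm_bounded_eventually hs ?_
  have hfin : {l : L.lattice | ¬ (2 * ‖z‖ + 1 ≤ ‖l‖)}.Finite := by
    refine (isCompact_iff_finite.mp (isCompact_closedBall (0 : L.lattice) (2 * ‖z‖ + 1))).subset ?_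
    intro l hl
    simp at hl ⊢
    exact hl.le
  filter_upwards [hfin.compl_mem_cofinite] with l hl
  simp only [Set.mem_compl_iff, Set.mem_ofPred_eq, not_not] at hl
  have hln : ‖l‖ = ‖(l : ℂ)‖ := rfl
  rw [hln] at hl ⊢
  have hz := norm_nonneg z
  have hl0 : 0 < ‖(l : ℂ)‖ := by linarith
  have hl0' : (l : ℂ) ≠ 0 := norm_pos_iff.1 hl0
  have hzl : ‖(l : ℂ)‖ / 2 ≤ ‖z - l‖ := by
    rw [norm_sub_rev]
    exact le_trans (by linarith) (norm_sub_norm_le (l : ℂ) z)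
  have hzl0 : z - l ≠ 0 := norm_pos_iff.1 (by linarith)
  have e : 1 / (z - l) + 1 / (l : ℂ) + z / (l : ℂ) ^ 2 = z ^ 2 / ((l : ℂ) ^ 2 * (z - l)) := by
    field_simp
    ring
  have e3 : ‖(l : ℂ)‖ ^ (-3 : ℝ) = (‖(l : ℂ)‖ ^ 3)⁻¹ := by
    rw [Real.rpow_neg hl0.le]; norm_cast
  rw [e, e3, norm_div, norm_mul, norm_pow, norm_pow, div_le_iff₀ (by positivity)]
  calc ‖z‖ ^ 2 = 2 * ‖z‖ ^ 2 * (‖(l : ℂ)‖ ^ 3)⁻¹ * (‖(l : ℂ)‖ ^ 2 * (‖(l : ℂ)‖ / 2)) := by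
        field_simp
    _ ≤ _ := by gcongr

lemma wzeta_eq (r : ℝ) (hr : 0 < r) (z : ℂ) :
    wzeta r z = ∑' l : (PP r hr).lattice, (1 / (z - l) + 1 / (l : ℂ) + z / (l : ℂ) ^ 2) := by
  set L := PP r hr
  have e : ∀ p : ℤ × ℤ, ((L.latticeEquivProd.symm p : L.lattice) : ℂ) = latPt r p := by
    intro p
    rw [latticeEquiv_symm_apply]
    simp only [L, PP, latPt]; ring
  rw [← L.latticeEquivProd.symm.toEquiv.tsum_eq]
  have hs := zeta_bound L z
  rw [← L.latticeEquivProd.symm.toEquiv.summable_iff] at hs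
  refine Eq.trans ?_ (hs.tsum_eq_add_tsum_ite (0 : ℤ × ℤ)).symm
  unfold wzeta
  congr 1
  · simp
  · refine tsum_congr fun p => ?_
    simp [e]

lemma wzeta_neg (r : ℝ) (hr : 0 < r) (z : ℂ) : wzeta r (-z) = - wzeta r z := by
  rw [wzeta_eq r hr, wzeta_eq r hr, ← tsum_neg, ← (Equiv.neg _).tsum_eq]
  refine tsum_congr fun l => ?_
  have : -z - -(l : ℂ) = -(z - l) := by ring
  simp only [Equiv.neg_apply, Submodule.coe_neg, this, div_neg, neg_div, neg_sq]
  ring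

lemma hasDerivAt_wzeta (r : ℝ) (hr : 0 < r) (z : ℂ) (hz : z ∉ (PP r hr).lattice) :
    HasDerivAt (wzeta r) (- (PP r hr).weierstrassP z) z := by
  set L := PP r hr
  have h1 := L.hasSumLocallyUniformly_weierstrassP.hasSumLocallyUniformlyOn (s := (L.lattice : Set ℂ)ᶜ)
  rw [hasSumLocallyUniformlyOn_iff_tendstoLocallyUniformlyOn] at h1
  have h2 := hasDerivAt_of_tendstoLocallyUniformlyOn (x := z) (g := fun z => - wzeta r z)
    (f := fun (s : Finset L.lattice) (z : ℂ) =>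
      ∑ l ∈ s, -(1 / (z - l) + 1 / (l : ℂ) + z / (l : ℂ) ^ 2))
    L.isClosed_lattice.isOpen_compl h1 ?_ ?_ hz
  · have h3 := h2.fun_neg
    simpa only [neg_neg] using h3
  · refine Eventually.of_forall fun s x hx => ?_
    refine HasDerivAt.fun_sum fun l _ => ?_
    have hne : x - l ≠ 0 := by
      rw [sub_ne_zero]; rintro rfl; exact hx l.2
    have := ((((hasDerivAt_id x).sub_const (l : ℂ)).inv hne).add_const (1 / (l : ℂ))).add
      ((hasDerivAt_id x).div_const ((l : ℂ) ^ 2))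
    convert this.neg using 1
    · ext y; simp
    · simp; ring
  · intro x _
    have := (zeta_bound L x).hasSum
    rw [← wzeta_eq r hr] at this
    exact this.neg

end zeta

/-! ### The infinite product -/

section product
open Filter Topology

/-- `∏ (1 - Q^n x)`. -/
noncomputable def qprod (Q : ℝ) (x : ℂ) : ℂ := ∏' n : ℕ, (1 + -((Q : ℂ) ^ n * x))

variable {Q : ℝ}

lemma qprod_summable (h0 : 0 < Q) (h1 : Q < 1) (x : ℂ) :
    Summable fun n : ℕ => ‖-((Q : ℂ) ^ n * x)‖ := by
  simp only [norm_neg, norm_mul, norm_pow]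
  refine (summable_geometric_of_lt_one (norm_nonneg _) ?_).mul_right _
  simpa [abs_of_pos h0] using h1

lemma qprod_ne_zero (h0 : 0 < Q) (h1 : Q < 1) (x : ℂ) (hx : ∀ n : ℕ, (Q : ℂ) ^ n * x ≠ 1) :
    qprod Q x ≠ 0 := by
  refine tprod_one_add_ne_zero_of_summable ?_ (qprod_summable h0 h1 x)
  intro n h
  exact hx n (by linear_combination -h)

lemma qprod_step (h0 : 0 < Q) (h1 : Q < 1) (x : ℂ) :
    qprod Q x = (1 - x) * qprod Q (Q * x) := by
  unfold qprod
  have h := multipliable_one_add_of_summable (qprod_summable h0 h1 (Q * x))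
  rw [tprod_eq_zero_mul']
  · congr 1
    · simp; ring
    · refine tprod_congr fun n => ?_
      ring
  · refine h.congr fun n => ?_
    ring

lemma qprod_diff (h0 : 0 < Q) (h1 : Q < 1) : Differentiable ℂ (qprod Q) := by
  intro x
  set K := Metric.ball (0 : ℂ) (‖x‖ + 1)
  have hK : IsOpen K := Metric.isOpen_ball
  have h : HasProdLocallyUniformlyOn (fun (n : ℕ) (y : ℂ) => 1 + -((Q : ℂ) ^ n * y))
      (fun y => ∏' n : ℕ, (1 + -((Q : ℂ) ^ n * y))) K := by
    refine Summable.hasProdLocallyUniformlyOn_nat_one_add hK (u := fun n => Q ^ n * (‖x‖ + 1))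
      ((summable_geometric_of_lt_one h0.le h1).mul_right _) ?_ ?_
    · refine Eventually.of_forall fun n y hy => ?_
      simp only [norm_neg, norm_mul, norm_pow, Complex.norm_real, Real.norm_eq_abs, abs_of_pos h0]
      have : ‖y‖ ≤ ‖x‖ + 1 := by simpa [K] using (Metric.mem_ball.1 hy).le
      gcongr
    · intro n; fun_prop
  have h2 := h.differentiableOn (.of_forall fun _ ↦ by
    simpa [Finset.prod_fn] using DifferentiableOn.finsetProd (fun _ _ ↦ by fun_prop)) hK
  exact h2.differentiableAt (hK.mem_nhds (by simp [K]))

end product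

/-! ### Theta -/
section theta
open Filter Topology

lemma Theta_eq (r : ℝ) (z : ℂ) :
    Theta r z = (1 / Complex.I) * (Complex.exp (-(r : ℂ) / 4) * Complex.exp (Complex.I * z / 2) *
      jacobiTheta₂ (1 / 2 + z / (2 * Real.pi) + Complex.I * r / (2 * Real.pi))
        (Complex.I * r / Real.pi)) := by
  have hpi : (Real.pi : ℂ) ≠ 0 := by exact_mod_cast Real.pi_ne_zero
  unfold Theta jacobiTheta₂
  congr 1
  refine Eq.trans ?_ tsum_mul_left
  refine tsum_congr fun n => ?_
  unfold jacobiTheta₂_term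
  have : (-1 : ℂ) ^ n = Complex.exp (n * (Real.pi * Complex.I)) := by
    rw [Complex.exp_int_mul, Complex.exp_pi_mul_I]
  rw [this, ← Complex.exp_add, ← Complex.exp_add, ← Complex.exp_add, ← Complex.exp_add]
  congr 1
  field_simp
  linear_combination (-(r:ℂ) * n - r * n^2) * Complex.I_sq * 16

lemma tau_im {r : ℝ} (hr : 0 < r) : 0 < (Complex.I * r / Real.pi : ℂ).im := by
  have : (Complex.I * r / Real.pi : ℂ) = ((r / Real.pi : ℝ) : ℂ) * Complex.I := by
    push_cast; ring
  rw [this]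
  simp
  positivity

lemma Theta_diff {r : ℝ} (hr : 0 < r) : Differentiable ℂ (Theta r) := by
  have h : Theta r = fun z => _ := funext (Theta_eq r)
  rw [h]
  intro z
  have h1 : DifferentiableAt ℂ (fun z : ℂ => jacobiTheta₂ (1 / 2 + z / (2 * Real.pi) +
      Complex.I * r / (2 * Real.pi)) (Complex.I * r / Real.pi)) z :=
    (differentiableAt_jacobiTheta₂_fst _ (tau_im hr)).comp z (f := fun z : ℂ =>
      (1 / 2 + z / (2 * Real.pi) + Complex.I * r / (2 * Real.pi) : ℂ)) (by fun_prop)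
  fun_prop

lemma Theta_add_two_pi (r : ℝ) (z : ℂ) : Theta r (z + 2 * Real.pi) = - Theta r z := by
  have hpi : (Real.pi : ℂ) ≠ 0 := by exact_mod_cast Real.pi_ne_zero
  rw [Theta_eq, Theta_eq]
  have e1 : (1 / 2 + (z + 2 * Real.pi) / (2 * Real.pi) + Complex.I * r / (2 * Real.pi) : ℂ)
      = (1 / 2 + z / (2 * Real.pi) + Complex.I * r / (2 * Real.pi)) + 1 := by
    field_simp
    ring
  have e2 : Complex.I * (z + 2 * Real.pi) / 2 = Complex.I * z / 2 + Real.pi * Complex.I := by ring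
  rw [e1, jacobiTheta₂_add_left, e2, Complex.exp_add, Complex.exp_pi_mul_I]
  ring

lemma Theta_add_tau (r : ℝ) (z : ℂ) :
    Theta r (z + 2 * Complex.I * r) = - Complex.exp (r - Complex.I * z) * Theta r z := by
  have hpi : (Real.pi : ℂ) ≠ 0 := by exact_mod_cast Real.pi_ne_zero
  rw [Theta_eq, Theta_eq]
  have e1 : (1 / 2 + (z + 2 * Complex.I * r) / (2 * Real.pi) + Complex.I * r / (2 * Real.pi) : ℂ)
      = (1 / 2 + z / (2 * Real.pi) + Complex.I * r / (2 * Real.pi)) + Complex.I * r / Real.pi := by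
    field_simp
    ring
  rw [e1, jacobiTheta₂_add_left']
  have e2 : Complex.exp (Complex.I * (z + 2 * Complex.I * r) / 2) *
      Complex.exp (-(Real.pi : ℂ) * Complex.I * (Complex.I * r / Real.pi +
        2 * (1 / 2 + z / (2 * Real.pi) + Complex.I * r / (2 * Real.pi)))) =
      - Complex.exp (r - Complex.I * z) * Complex.exp (Complex.I * z / 2) := by
    rw [← Complex.exp_add, neg_mul (Complex.exp _), ← Complex.exp_add]
    have : Complex.I * (z + 2 * Complex.I * r) / 2 + -(Real.pi : ℂ) * Complex.I * (Complex.I * r / Real.pi +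
        2 * (1 / 2 + z / (2 * Real.pi) + Complex.I * r / (2 * Real.pi))) =
        r - Complex.I * z + Complex.I * z / 2 - Real.pi * Complex.I := by
      field_simp
      linear_combination (-2 * (r : ℂ)) * Complex.I_sq
    rw [this, Complex.exp_sub _ (Real.pi * Complex.I), Complex.exp_pi_mul_I]
    ring
  linear_combination (1 / Complex.I) * Complex.exp (-(r : ℂ) / 4) * jacobiTheta₂
    (1 / 2 + z / (2 * Real.pi) + Complex.I * r / (2 * Real.pi)) (Complex.I * r / Real.pi) * e2

lemma Theta_neg (r : ℝ) (z : ℂ) : Theta r (-z) = - Theta r z := by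
  unfold Theta
  rw [← mul_neg, ← tsum_neg]
  congr 1
  let e : ℤ ≃ ℤ := Equiv.subLeft (-1)
  rw [← e.tsum_eq]
  refine tsum_congr fun n => ?_
  have e1 : (-1 : ℂ) ^ (e n) = - (-1 : ℂ) ^ n := by
    have : e n = -1 - n := rfl
    rw [this, zpow_sub₀ (by norm_num)]
    rcases Int.even_or_odd n with h | h
    · simp [h.neg_one_zpow]
    · simp [h.neg_one_zpow]
  have e2 : ((e n : ℤ) : ℂ) + 1 / 2 = -((n : ℂ) + 1 / 2) := by
    have : e n = -1 - n := rfl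
    rw [this]; push_cast; ring
  rw [e1, e2]
  have e3 : -((n : ℂ) + 1 / 2) * Complex.I * -z = ((n : ℂ) + 1 / 2) * Complex.I * z := by ring
  rw [e3, neg_sq]
  ring

lemma Theta_exists_ne {r : ℝ} (hr : 0 < r) : ∃ z, Theta r z ≠ 0 := by
  have hpi : (Real.pi : ℂ) ≠ 0 := by exact_mod_cast Real.pi_ne_zero
  refine ⟨-(Real.pi : ℂ) - Complex.I * r, ?_⟩
  rw [Theta_eq]
  have e : (1 / 2 + (-(Real.pi : ℂ) - Complex.I * r) / (2 * Real.pi) +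
      Complex.I * r / (2 * Real.pi) : ℂ) = 0 := by
    field_simp
    ring
  rw [e]
  have hj : jacobiTheta₂ 0 (Complex.I * r / Real.pi) = ((∑' n : ℤ, Real.exp (-r * n ^ 2) : ℝ) : ℂ) := by
    unfold jacobiTheta₂
    rw [Complex.ofReal_tsum]
    refine tsum_congr fun n => ?_
    unfold jacobiTheta₂_term
    push_cast
    congr 1
    field_simp
    linear_combination (r : ℂ) * n ^ 2 * Complex.I_sq
  have hs := (summable_jacobiTheta₂_term_iff 0 (Complex.I * r / Real.pi)).2 (tau_im hr)
  have hs2 : Summable fun n : ℤ => Real.exp (-r * n ^ 2) := by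
    refine hs.norm.congr fun n => ?_
    rw [norm_jacobiTheta₂_term]
    have : (Complex.I * r / Real.pi : ℂ) = ((r / Real.pi : ℝ) : ℂ) * Complex.I := by
      push_cast; ring
    rw [this]
    have h2 := Real.pi_ne_zero
    simp
    field_simp
  have hpos : 0 < ∑' n : ℤ, Real.exp (-r * n ^ 2) :=
    hs2.tsum_pos (fun n => (Real.exp_pos _).le) 0 (Real.exp_pos _)
  rw [hj]
  have h3 : ((∑' n : ℤ, Real.exp (-r * n ^ 2) : ℝ) : ℂ) ≠ 0 := by exact_mod_cast hpos.ne'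
  have := Complex.exp_ne_zero
  simp only [ne_eq, mul_eq_zero, this, h3, or_self, or_false]
  simp

end theta

section main
open Filter Topology

lemma periodic_off (L : PeriodPair) (f : ℂ → ℂ) (S : Set ℂ)
    (hS : ∀ l ∈ L.lattice, ∀ y, y + l ∈ S ↔ y ∈ S)
    (h1 : ∀ y, y ∉ S → f (y + L.ω₁) = f y) (h2 : ∀ y, y ∉ S → f (y + L.ω₂) = f y) :
    ∀ l ∈ L.lattice, ∀ y, y ∉ S → f (y + l) = f y := by
  classical
  let g : ℂ → ℂ := fun y => if y ∈ S then 0 else f y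
  have key : ∀ l ∈ L.lattice, (∀ y, y ∉ S → f (y + l) = f y) → Function.Periodic g l := by
    intro l hl h y
    simp only [g, hS l hl]
    split_ifs with hy
    · rfl
    · exact h y hy
  have g1 := key _ L.ω₁_mem_lattice h1
  have g2 := key _ L.ω₂_mem_lattice h2
  intro l hl y hy
  obtain ⟨m, n, rfl⟩ := PeriodPair.mem_lattice.1 hl
  have := (g1.int_mul m).add_period (g2.int_mul n) y
  simp only [g, hS _ hl, hy, if_false] at this
  exact this

lemma tendsto_div_zero {f g : ℂ → ℂ} {f' g' : ℂ} (hf : HasDerivAt f f' 0) (hg : HasDerivAt g g' 0)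
    (f0 : f 0 = 0) (g0 : g 0 = 0) (hg' : g' ≠ 0) :
    Tendsto (fun z => f z / g z) (𝓝[≠] 0) (𝓝 (f' / g')) := by
  have := (hasDerivAt_iff_tendsto_slope.1 hf).div (hasDerivAt_iff_tendsto_slope.1 hg) hg'
  refine this.congr' ?_
  filter_upwards [self_mem_nhdsWithin] with z hz
  have hz : z ≠ 0 := hz
  simp only [Pi.div_apply, slope_def_field, f0, g0, sub_zero]
  field_simp

lemma Q_lt (r : ℝ) (hr : 0 < r) : Real.exp (-2 * r) < 1 := by
  rw [Real.exp_lt_one_iff]; linarith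

/-- The theta product (up to a factor). -/
noncomputable def thP (r : ℝ) (z : ℂ) : ℂ :=
  qprod (Real.exp (-2 * r)) (Complex.exp (Complex.I * z)) *
    qprod (Real.exp (-2 * r)) ((Real.exp (-2 * r) : ℝ) * Complex.exp (-(Complex.I * z)))

lemma thP_diff {r : ℝ} (hr : 0 < r) : Differentiable ℂ (thP r) := by
  have h := qprod_diff (Real.exp_pos (-2 * r)) (Q_lt r hr)
  unfold thP
  fun_prop

lemma thP_add_two_pi (r : ℝ) (z : ℂ) : thP r (z + 2 * Real.pi) = thP r z := by
  unfold thP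
  have e : Complex.I * (z + 2 * Real.pi) = Complex.I * z + 2 * Real.pi * Complex.I := by ring
  rw [e, neg_add, Complex.exp_add, Complex.exp_add, Complex.exp_neg (2 * Real.pi * Complex.I),
    Complex.exp_two_pi_mul_I]
  simp

lemma thP_add_tau {r : ℝ} (hr : 0 < r) (z : ℂ) :
    thP r (z + 2 * Complex.I * r) = - Complex.exp (-(Complex.I * z)) * thP r z := by
  unfold thP
  set Q := Real.exp (-2 * r) with hQ
  set x := Complex.exp (Complex.I * z) with hx
  have hx0 : x ≠ 0 := Complex.exp_ne_zero _
  have hQ0 : (Q : ℂ) ≠ 0 := by rw [hQ]; exact_mod_cast (Real.exp_pos _).ne'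
  have hQc : (Q : ℂ) = Complex.exp (-2 * r) := by rw [hQ]; push_cast; rfl
  have e1 : Complex.exp (Complex.I * (z + 2 * Complex.I * r)) = Q * x := by
    rw [hQc, hx, ← Complex.exp_add]
    congr 1
    linear_combination 2 * (r : ℂ) * Complex.I_sq
  rw [Complex.exp_neg, Complex.exp_neg, e1, ← hx]
  have e2 : (Q : ℂ) * (Q * x)⁻¹ = x⁻¹ := by field_simp
  rw [e2, qprod_step (Real.exp_pos _) (Q_lt r hr) x, qprod_step (Real.exp_pos _) (Q_lt r hr) x⁻¹,
    ← hQ]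
  field_simp
  ring

lemma thP_ne_zero {r : ℝ} (hr : 0 < r) (z : ℂ) (hz : z ∉ ThetaLattice r) : thP r z ≠ 0 := by
  have key : ∀ n : ℤ, Complex.exp (-2 * r * n + Complex.I * z) ≠ 1 := by
    intro n h
    rw [Complex.exp_eq_one_iff] at h
    obtain ⟨m, hm⟩ := h
    apply hz
    refine ⟨m, -n, ?_⟩
    push_cast
    linear_combination (-Complex.I) * hm + (z - 2 * m * Real.pi) * Complex.I_sq
  have hQc : ((Real.exp (-2 * r) : ℝ) : ℂ) = Complex.exp (-2 * r) := by push_cast; rfl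
  refine mul_ne_zero (qprod_ne_zero (Real.exp_pos _) (Q_lt r hr) _ ?_)
    (qprod_ne_zero (Real.exp_pos _) (Q_lt r hr) _ ?_)
  · intro n h
    apply key n
    rw [hQc, ← Complex.exp_nat_mul, ← Complex.exp_add] at h
    rw [← h]; congr 1; push_cast; ring
  · intro n h
    apply key (-(n + 1))
    rw [hQc, ← Complex.exp_nat_mul, ← Complex.exp_add, ← Complex.exp_add] at h
    rw [← inv_inj, ← Complex.exp_neg, inv_one, ← h]; congr 1; push_cast; ring

lemma thP_zero {r : ℝ} (hr : 0 < r) : thP r 0 = 0 ∧ ∃ c ≠ 0, HasDerivAt (thP r) c 0 := by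
  set Q := Real.exp (-2 * r) with hQ
  have hQ0 : 0 < Q := Real.exp_pos (-2 * r)
  have hQ1 : Q < 1 := Q_lt r hr
  let B : ℂ → ℂ := fun z => qprod Q (Q * Complex.exp (Complex.I * z)) *
    qprod Q (Q * Complex.exp (-(Complex.I * z)))
  have e : thP r = fun z => (1 - Complex.exp (Complex.I * z)) * B z := by
    ext z
    unfold thP
    rw [← hQ, qprod_step hQ0 hQ1 (Complex.exp (Complex.I * z))]
    simp only [B]
    ring
  have hB : DifferentiableAt ℂ B 0 := by
    have h := qprod_diff hQ0 hQ1
    simp only [B]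
    fun_prop
  have hq : qprod Q Q ≠ 0 := by
    refine qprod_ne_zero hQ0 hQ1 _ fun n h => ?_
    have h' : Q ^ n * Q = 1 := by exact_mod_cast h
    have : Q ^ (n + 1) < 1 := pow_lt_one₀ hQ0.le hQ1 (by omega)
    rw [pow_succ] at this
    linarith
  have hB0 : B 0 ≠ 0 := by simp [B, hq]
  refine ⟨by rw [e]; simp, -Complex.I * B 0, by simp [hB0], ?_⟩
  rw [e]
  have h1 : HasDerivAt (fun z : ℂ => 1 - Complex.exp (Complex.I * z)) (-Complex.I) 0 := by
    have := (((hasDerivAt_id (0 : ℂ)).const_mul Complex.I).cexp).const_sub 1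
    simpa using this
  simpa using h1.fun_mul hB.hasDerivAt

lemma Theta_main {r : ℝ} (hr : 0 < r) :
    deriv (Theta r) 0 ≠ 0 ∧ ∀ z, z ∉ ThetaLattice r → Theta r z ≠ 0 := by
  let T : ℂ → ℂ := fun z => Complex.exp (Complex.I * z / 2) * Theta r z
  have hΘ := Theta_diff hr
  have hP := thP_diff hr
  have hT : Differentiable ℂ T := by simp only [T]; fun_prop
  let f : ℂ → ℂ := fun z => T z / thP r z
  have hΘ0 : Theta r 0 = 0 := by
    have := Theta_neg r 0
    rw [neg_zero] at this
    exact self_eq_neg.1 this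
  obtain ⟨hP0, c, hc, hPc⟩ := thP_zero hr
  have hT' : HasDerivAt T (deriv (Theta r) 0) 0 := by
    have h1 : HasDerivAt (fun z : ℂ => Complex.exp (Complex.I * z / 2)) (Complex.I / 2) 0 := by
      have := ((((hasDerivAt_id (0 : ℂ)).const_mul Complex.I).div_const 2).cexp)
      simpa using this
    simpa [hΘ0] using h1.fun_mul (hΘ 0).hasDerivAt
  have hlim0 := tendsto_div_zero hT' hPc (by simp [T, hΘ0]) hP0 hc
  have hfd : ∀ x, x ∉ (PP r hr).lattice → DifferentiableAt ℂ f x := by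
    intro x hx
    rw [mem_PP] at hx
    exact (hT x).div (hP x) (thP_ne_zero hr x hx)
  have hL : ∃ C, ∀ x, Tendsto f (𝓝[≠] x) (𝓝 C) := by
    refine liouville_periodic (PP r hr) f ?_ ?_ ?_
    · intro l hl x
      refine Eventually.of_forall fun y => ?_
      refine periodic_off (PP r hr) f ∅ (by simp) ?_ ?_ l hl y (by simp)
      · intro y _
        simp only [f, T, PP]
        rw [thP_add_two_pi, Theta_add_two_pi]
        have : Complex.I * (y + 2 * Real.pi) / 2 = Complex.I * y / 2 + Real.pi * Complex.I := by ring
        rw [this, Complex.exp_add, Complex.exp_pi_mul_I]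
        ring
      · intro y _
        simp only [f, T, PP]
        rw [thP_add_tau hr, Theta_add_tau]
        have : Complex.exp (Complex.I * (y + 2 * Complex.I * r) / 2) *
            (-Complex.exp (r - Complex.I * y) * Theta r y) =
            - Complex.exp (-(Complex.I * y)) * (Complex.exp (Complex.I * y / 2) * Theta r y) := by
          have h3 : Complex.exp (Complex.I * (y + 2 * Complex.I * r) / 2) * Complex.exp (r - Complex.I * y)
              = Complex.exp (-(Complex.I * y)) * Complex.exp (Complex.I * y / 2) := by
            rw [← Complex.exp_add, ← Complex.exp_add]
            congr 1
            linear_combination (r : ℂ) * Complex.I_sq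
          linear_combination (-Theta r y) * h3
        rw [this, mul_div_mul_left _ _ (neg_ne_zero.2 (Complex.exp_ne_zero _))]
    · intro x
      filter_upwards [eventually_notMem (PP r hr) x] with y hy using hfd y hy
    · intro x
      by_cases hx : x ∈ (PP r hr).lattice
      · exact ⟨-x, neg_mem hx, _, by rw [add_neg_cancel]; exact hlim0⟩
      · exact ⟨0, zero_mem _, f x, by
          rw [add_zero]
          exact (hfd x hx).continuousAt.tendsto.mono_left nhdsWithin_le_nhds⟩
  obtain ⟨C, hC⟩ := hL
  have hCe : deriv (Theta r) 0 / c = C := tendsto_nhds_unique hlim0 (hC 0)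
  have hfC : ∀ x, x ∉ (PP r hr).lattice → f x = C := fun x hx =>
    tendsto_nhds_unique ((hfd x hx).continuousAt.tendsto.mono_left nhdsWithin_le_nhds) (hC x)
  have hC0 : C ≠ 0 := by
    intro h0
    obtain ⟨z, hz⟩ := Theta_exists_ne hr
    apply hz
    have h1 : Tendsto (Theta r) (𝓝[≠] z) (𝓝 (Theta r z)) :=
      hΘ.continuous.continuousAt.tendsto.mono_left nhdsWithin_le_nhds
    refine tendsto_nhds_unique_of_eventuallyEq h1 (tendsto_const_nhds (x := (0 : ℂ))) ?_
    filter_upwards [eventually_notMem (PP r hr) z] with y hy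
    have h2 := hfC y hy
    rw [mem_PP] at hy
    simp only [f, h0, div_eq_zero_iff, thP_ne_zero hr y hy, or_false, T, mul_eq_zero,
      Complex.exp_ne_zero, false_or] at h2
    exact h2
  constructor
  · intro h
    rw [h, zero_div] at hCe
    exact hC0 hCe.symm
  · intro z hz h
    rw [← mem_PP r hr] at hz
    have := hfC z hz
    simp only [f, T, h, mul_zero, zero_div] at this
    exact hC0 this.symm

end main

section kernel
open Filter Topology

variable {r : ℝ}

lemma H_an (hr : 0 < r) {z : ℂ} (hz : z ∉ (PP r hr).lattice) : AnalyticAt ℂ (Hker r) z := by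
  have h1 : AnalyticAt ℂ (Theta r) z := (Theta_diff hr).analyticAt z
  have h2 := h1.deriv
  rw [mem_PP] at hz
  have h3 := (Theta_main hr).2 z hz
  unfold Hker
  fun_prop (disch := assumption)

lemma H_neg (z : ℂ) : Hker r (-z) = - Hker r z := by
  have h : (fun z => Theta r (-z)) = fun z => - Theta r z := funext (Theta_neg r)
  have h2 := congrArg (fun f => deriv f z) h
  simp only [deriv_comp_neg, deriv.fun_neg] at h2
  unfold Hker
  rw [neg_inj.1 h2, Theta_neg, div_neg]

lemma dH_neg (z : ℂ) : deriv (Hker r) (-z) = deriv (Hker r) z := by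
  have h : (fun z => Hker r (-z)) = fun z => - Hker r z := funext H_neg
  have h2 := congrArg (fun f => deriv f z) h
  simp only [deriv_comp_neg, deriv.fun_neg] at h2
  exact neg_inj.1 h2

lemma H_add_two_pi (z : ℂ) : Hker r (z + 2 * Real.pi) = Hker r z := by
  have h : (fun z => Theta r (z + 2 * Real.pi)) = fun z => - Theta r z :=
    funext (Theta_add_two_pi r)
  have h2 := congrArg (fun f => deriv f z) h
  simp only [deriv_comp_add_const, deriv.fun_neg] at h2
  unfold Hker
  rw [h2, Theta_add_two_pi, mul_neg, neg_div_neg_eq]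

lemma H_add_tau (hr : 0 < r) {z : ℂ} (hz : z ∉ (PP r hr).lattice) :
    Hker r (z + 2 * Complex.I * r) = Hker r z - 2 * Complex.I := by
  rw [mem_PP] at hz
  have h3 := (Theta_main hr).2 z hz
  have h : (fun z => Theta r (z + 2 * Complex.I * r)) =
      fun z => - Complex.exp (r - Complex.I * z) * Theta r z := funext (Theta_add_tau r)
  have h2 := congrArg (fun f => deriv f z) h
  have h4 : HasDerivAt (fun z : ℂ => - Complex.exp (r - Complex.I * z))
      (Complex.I * Complex.exp (r - Complex.I * z)) z := by
    have := (((hasDerivAt_id z).const_mul Complex.I).const_sub (r : ℂ)).cexp.fun_neg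
    refine this.congr_deriv ?_
    simp only [id]
    ring
  simp only [deriv_comp_add_const, (h4.fun_mul (Theta_diff hr z).hasDerivAt).deriv] at h2
  unfold Hker
  rw [h2, Theta_add_tau]
  have := Complex.exp_ne_zero (r - Complex.I * z)
  field_simp
  ring

lemma mem_add_iff (hr : 0 < r) {l : ℂ} (hl : l ∈ (PP r hr).lattice) (y : ℂ) :
    y + l ∈ (PP r hr).lattice ↔ y ∈ (PP r hr).lattice :=
  add_mem_cancel_right hl

lemma dH_per (hr : 0 < r) {l : ℂ} (hl : l ∈ (PP r hr).lattice) {y : ℂ} (hy : y ∉ (PP r hr).lattice) :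
    deriv (Hker r) (y + l) = deriv (Hker r) y := by
  refine periodic_off (PP r hr) (deriv (Hker r)) (PP r hr).lattice
    (fun l hl y => mem_add_iff hr hl y) ?_ ?_ l hl y hy
  · intro y _
    have h : (fun z => Hker r (z + 2 * Real.pi)) = Hker r := funext H_add_two_pi
    have h2 := congrArg (fun f => deriv f y) h
    simp only [deriv_comp_add_const] at h2
    exact h2
  · intro y hy
    have h : (fun z => Hker r (z + 2 * Complex.I * r)) =ᶠ[𝓝 y] fun z => Hker r z - 2 * Complex.I := by
      filter_upwards [(PP r hr).isClosed_lattice.isOpen_compl.mem_nhds hy] with z hz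
      exact H_add_tau hr hz
    have h2 := h.deriv_eq
    simp only [deriv_comp_add_const, deriv_sub_const] at h2
    exact h2

lemma H_local (hr : 0 < r) : ∃ K : ℂ → ℂ, AnalyticAt ℂ K 0 ∧ K 0 = 0 ∧
    ∀ᶠ z in 𝓝[≠] (0 : ℂ), Hker r z = 2 / z + K z ∧ deriv (Hker r) z = -2 / z ^ 2 + deriv K z := by
  have hΘ := Theta_diff hr
  have hΘ0 : Theta r 0 = 0 := by
    have := Theta_neg r 0
    rw [neg_zero] at this
    exact self_eq_neg.1 this
  let U := dslope (Theta r) 0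
  have hU : Differentiable ℂ U := by
    rw [← differentiableOn_univ, Complex.differentiableOn_dslope univ_mem]
    exact hΘ.differentiableOn
  have hU0 : U 0 ≠ 0 := by
    simp only [U, dslope_same]
    exact (Theta_main hr).1
  have hΘU : ∀ z, Theta r z = z * U z := by
    intro z
    have := sub_smul_dslope (Theta r) 0 z
    simp only [sub_zero, hΘ0, smul_eq_mul] at this
    exact this.symm
  have hU1 : AnalyticAt ℂ U 0 := hU.analyticAt 0
  have hU2 := hU1.deriv
  let K : ℂ → ℂ := fun z => 2 * deriv U z / U z
  have hK : AnalyticAt ℂ K 0 := by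
    simp only [K]
    fun_prop (disch := assumption)
  have hev : ∀ᶠ z in 𝓝[≠] (0 : ℂ), Hker r z = 2 / z + K z := by
    filter_upwards [self_mem_nhdsWithin,
      mem_nhdsWithin_of_mem_nhds (hU.continuous.continuousAt.eventually_ne hU0)] with z hz hUz
    have hz : z ≠ 0 := hz
    have hUz : U z ≠ 0 := hUz
    have h1 : deriv (Theta r) z = U z + z * deriv U z := by
      have : Theta r = fun z => z * U z := funext hΘU
      rw [this]
      simpa using ((hasDerivAt_id z).fun_mul (hU z).hasDerivAt).deriv
    simp only [Hker, K]
    rw [h1, hΘU]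
    field_simp
  refine ⟨K, hK, ?_, ?_⟩
  · have h1 : Tendsto (fun z : ℂ => -z) (𝓝[≠] 0) (𝓝[≠] 0) := by
      refine tendsto_nhdsWithin_iff.2 ⟨?_, ?_⟩
      · have := (continuous_neg (G := ℂ)).tendsto 0
        rw [neg_zero] at this
        exact this.mono_left nhdsWithin_le_nhds
      · filter_upwards [self_mem_nhdsWithin] with y hy
        simpa using hy
    have h2 := h1.eventually hev
    have hKt : Tendsto K (𝓝[≠] 0) (𝓝 (K 0)) :=
      hK.continuousAt.tendsto.mono_left nhdsWithin_le_nhds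
    have h3 : Tendsto (fun z => K (-z)) (𝓝[≠] 0) (𝓝 (K 0)) := hKt.comp h1
    have h4 : K 0 = - K 0 := by
      refine tendsto_nhds_unique h3 (hKt.neg.congr' ?_)
      filter_upwards [hev, h2] with z hz hz'
      rw [H_neg, hz] at hz'
      rw [div_neg] at hz'
      linear_combination hz'
    exact self_eq_neg.1 h4
  · have hev2 := hev
    rw [← eventually_eventually_nhdsWithin] at hev2
    filter_upwards [hev, hev2, self_mem_nhdsWithin,
      mem_nhdsWithin_of_mem_nhds hK.eventually_analyticAt] with z hz hz2 hz0 hKz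
    refine ⟨hz, ?_⟩
    rw [IsOpen.nhdsWithin_eq isOpen_compl_singleton hz0] at hz2
    have hz0 : z ≠ 0 := hz0
    have hKz : AnalyticAt ℂ K z := hKz
    have h5 : Hker r =ᶠ[𝓝 z] fun z => 2 / z + K z := hz2
    rw [h5.deriv_eq]
    have := (((hasDerivAt_inv hz0).const_mul 2).fun_add hKz.differentiableAt.hasDerivAt).deriv
    simp only [div_eq_mul_inv]
    rw [this]
    ring

lemma zeta_pi (hr : 0 < r) (K : ℂ → ℂ) (hK : AnalyticAt ℂ K 0) 
    (hloc : ∀ᶠ z in 𝓝[≠] (0 : ℂ), Hker r z = 2 / z + K z ∧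
      deriv (Hker r) z = -2 / z ^ 2 + deriv K z) :
    2 * wzeta r Real.pi = - deriv K 0 * Real.pi := by
  set L := PP r hr with hL
  set a := deriv K 0
  let G : ℂ → ℂ := fun z => deriv (Hker r) z + 2 * L.weierstrassP z
  have hGd : ∀ x, x ∉ L.lattice → DifferentiableAt ℂ G x := by
    intro x hx
    have h1 := (H_an hr hx).deriv.differentiableAt
    have h2 := (L.analyticOnNhd_weierstrassP x hx).differentiableAt
    simp only [G]
    fun_prop
  have hlim0 : Tendsto G (𝓝[≠] 0) (𝓝 a) := by
    have h1 : Tendsto (fun z => deriv K z + 2 * L.weierstrassPExcept 0 z) (𝓝 0) (𝓝 a) := by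
      have h2 := hK.deriv.continuousAt
      have h3 := (L.analyticAt_weierstrassPExcept 0).continuousAt
      have h4 : ContinuousAt (fun z => deriv K z + 2 * L.weierstrassPExcept 0 z) 0 := by fun_prop
      have h5 := h4.tendsto
      simpa using h5
    refine (h1.mono_left nhdsWithin_le_nhds).congr' ?_
    filter_upwards [hloc, self_mem_nhdsWithin] with z hz hz0
    have hz0 : z ≠ 0 := hz0
    have h6 := L.weierstrassPExcept_add 0 z
    simp only [G, ← h6, hz.2]
    simp
    ring
  have hG : ∃ C, ∀ x, Tendsto G (𝓝[≠] x) (𝓝 C) := by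
    refine liouville_periodic L G ?_ ?_ ?_
    · intro l hl x
      filter_upwards [eventually_notMem L x] with y hy
      have := L.weierstrassP_add_coe y ⟨l, hl⟩
      simp only [G]
      rw [dH_per hr hl hy]
      simp only at this
      rw [this]
    · intro x
      filter_upwards [eventually_notMem L x] with y hy using hGd y hy
    · intro x
      by_cases hx : x ∈ L.lattice
      · exact ⟨-x, neg_mem hx, _, by rw [add_neg_cancel]; exact hlim0⟩
      · exact ⟨0, zero_mem _, G x, by
          rw [add_zero]
          exact (hGd x hx).continuousAt.tendsto.mono_left nhdsWithin_le_nhds⟩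
  obtain ⟨C, hC⟩ := hG
  have hCa : a = C := tendsto_nhds_unique hlim0 (hC 0)
  have hGa : ∀ x, x ∉ L.lattice → G x = a := fun x hx => by
    rw [hCa]
    exact tendsto_nhds_unique ((hGd x hx).continuousAt.tendsto.mono_left nhdsWithin_le_nhds) (hC x)
  let D : ℂ → ℂ := fun z => Hker r z - 2 * wzeta r z - a * z
  have hD : ∀ x, x ∉ L.lattice → HasDerivAt D 0 x := by
    intro x hx
    have h1 := (H_an hr hx).differentiableAt.hasDerivAt
    have h2 := hasDerivAt_wzeta r hr x hx
    have h3 := (h1.fun_sub (h2.const_mul 2)).fun_sub ((hasDerivAt_id x).const_mul a)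
    have h4 := hGa x hx
    simp only [G] at h4
    refine h3.congr_deriv ?_
    rw [← hL]
    linear_combination h4
  have hcount : (L.lattice : Set ℂ).Countable :=
    Set.countable_coe_iff.1 (L.latticeEquivProd.toEquiv.injective.countable)
  have hconn : IsPreconnected ((L.lattice : Set ℂ)ᶜ) :=
    (hcount.isPathConnected_compl_of_one_lt_rank
      (by rw [Complex.rank_real_complex]; norm_num)).isConnected.isPreconnected
  have hpi : (Real.pi : ℂ) ∉ L.lattice := by
    have := L.ω₁_div_two_notMem_lattice
    simpa [hL, PP] using this
  have hpi' : -(Real.pi : ℂ) ∉ L.lattice := by rwa [neg_mem_iff]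
  have hDc : D Real.pi = D (-Real.pi) := by
    refine L.isClosed_lattice.isOpen_compl.is_const_of_deriv_eq_zero hconn ?_ ?_ hpi hpi'
    · intro x hx
      exact (hD x hx).differentiableAt.differentiableWithinAt
    · intro x hx
      exact (hD x hx).deriv
  have hHpi : Hker r Real.pi = 0 := by
    have h1 := H_add_two_pi (r := r) (-Real.pi : ℂ)
    rw [H_neg] at h1
    have : -(Real.pi : ℂ) + 2 * Real.pi = Real.pi := by ring
    rw [this] at h1
    exact self_eq_neg.1 h1
  simp only [D, H_neg, wzeta_neg r hr, hHpi] at hDc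
  linear_combination (-1 / 2 : ℂ) * hDc

lemma key_identity (hr : 0 < r) (K : ℂ → ℂ) (hK : AnalyticAt ℂ K 0) (hK0 : K 0 = 0)
    (hloc : ∀ᶠ z in 𝓝[≠] (0 : ℂ), Hker r z = 2 / z + K z ∧
      deriv (Hker r) z = -2 / z ^ 2 + deriv K z)
    (z w : ℂ) (hz : z ∉ (PP r hr).lattice) (hw : w ∉ (PP r hr).lattice)
    (hzw : z - w ∉ (PP r hr).lattice) :
    (Hker r (z - w) - Hker r z + Hker r w) ^ 2 / 2 + deriv (Hker r) (z - w) + deriv (Hker r) z +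
      deriv (Hker r) w = 3 * deriv K 0 := by
  set L := PP r hr with hL
  let F : ℂ → ℂ := fun z => (Hker r (z - w) - Hker r z + Hker r w) ^ 2 / 2 +
    deriv (Hker r) (z - w) + deriv (Hker r) z + deriv (Hker r) w
  have hFd : ∀ x, x ∉ L.lattice → x - w ∉ L.lattice → DifferentiableAt ℂ F x := by
    intro x hx hxw
    have h1 := (H_an hr hx).deriv.differentiableAt
    have h2 := (H_an hr hx).differentiableAt
    have h3 : DifferentiableAt ℂ (fun x => Hker r (x - w)) x :=
      (H_an hr hxw).differentiableAt.comp x (f := fun x => x - w) (by fun_prop)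
    have h4 : DifferentiableAt ℂ (fun x => deriv (Hker r) (x - w)) x :=
      (H_an hr hxw).deriv.differentiableAt.comp x (f := fun x => x - w) (by fun_prop)
    simp only [F]
    fun_prop
  have hevw : ∀ x, ∀ᶠ y in 𝓝[≠] x, y - w ∉ L.lattice := by
    intro x
    have h1 : Tendsto (fun y => y - w) (𝓝[≠] x) (𝓝[≠] (x - w)) := by
      refine tendsto_nhdsWithin_iff.2 ⟨?_, ?_⟩
      · exact (Continuous.tendsto (by fun_prop) x).mono_left nhdsWithin_le_nhds
      · filter_upwards [self_mem_nhdsWithin] with y hy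
        simpa [sub_left_inj] using hy
    exact h1.eventually (eventually_notMem L (x - w))
  have hw' : 0 - w ∉ L.lattice := by rwa [zero_sub, neg_mem_iff]
  have hlim0 : Tendsto F (𝓝[≠] 0) (𝓝 (3 * deriv K 0)) := by
    let N : ℂ → ℂ := fun z => Hker r (z - w) + Hker r w - K z
    have hHw := (H_an hr hw').differentiableAt
    have hN : HasDerivAt N (deriv (Hker r) w - deriv K 0) 0 := by
      have h1 : HasDerivAt (fun z => Hker r (z - w)) (deriv (Hker r) w) 0 := by
        have := hHw.hasDerivAt.comp_sub_const 0 w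
        rwa [zero_sub, dH_neg] at this
      exact (h1.add_const _).fun_sub hK.differentiableAt.hasDerivAt
    have hN0 : N 0 = 0 := by
      simp only [N, zero_sub, H_neg, hK0]; ring
    have hNz := tendsto_div_zero hN (hasDerivAt_id 0) hN0 rfl one_ne_zero
    have hNt : Tendsto N (𝓝[≠] 0) (𝓝 0) := by
      have := hN.continuousAt.tendsto
      rw [hN0] at this
      exact this.mono_left nhdsWithin_le_nhds
    have hM : Tendsto (fun z => deriv (Hker r) (z - w)) (𝓝[≠] 0) (𝓝 (deriv (Hker r) w)) := by
      have h1 : ContinuousAt (fun z => deriv (Hker r) (z - w)) 0 :=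
        (H_an hr hw').deriv.continuousAt.comp (f := fun z => z - w) (by fun_prop)
      have h2 := h1.tendsto
      simp only [zero_sub, dH_neg] at h2
      exact h2.mono_left nhdsWithin_le_nhds
    have hKt : Tendsto (deriv K) (𝓝[≠] 0) (𝓝 (deriv K 0)) :=
      hK.deriv.continuousAt.tendsto.mono_left nhdsWithin_le_nhds
    have hall := (((((hNt.pow 2).div_const 2).sub (hNz.const_mul 2)).add hM).add hKt).add_const
      (deriv (Hker r) w)
    have hval : (0 : ℂ) ^ 2 / 2 - 2 * ((deriv (Hker r) w - deriv K 0) / 1) + deriv (Hker r) w +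
        deriv K 0 + deriv (Hker r) w = 3 * deriv K 0 := by ring
    rw [hval] at hall
    refine hall.congr' ?_
    filter_upwards [hloc, self_mem_nhdsWithin] with z hz hz0
    have hz0 : z ≠ 0 := hz0
    simp only [F, N, hz.1, hz.2, id]
    field_simp
    ring
  have hlimw : Tendsto F (𝓝[≠] w) (𝓝 (3 * deriv K 0)) := by
    have h1 : Tendsto (fun y => w - y) (𝓝[≠] w) (𝓝[≠] 0) := by
      refine tendsto_nhdsWithin_iff.2 ⟨?_, ?_⟩
      · have : Tendsto (fun y => w - y) (𝓝 w) (𝓝 (w - w)) :=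
          Continuous.tendsto (by fun_prop) w
        rw [sub_self] at this
        exact this.mono_left nhdsWithin_le_nhds
      · filter_upwards [self_mem_nhdsWithin] with y hy
        have hy : y ≠ w := hy
        simpa [sub_eq_zero] using hy.symm
    refine (hlim0.comp h1).congr fun y => ?_
    have e1 : w - y - w = -y := by ring
    have e2 : w - y = -(y - w) := by ring
    simp only [F, Function.comp]
    rw [e1, e2, H_neg, H_neg, dH_neg, dH_neg]
    ring
  have hF : ∃ C, ∀ x, Tendsto F (𝓝[≠] x) (𝓝 C) := by
    refine liouville_periodic L F ?_ ?_ ?_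
    · intro l hl x
      filter_upwards [eventually_notMem L x, hevw x] with y hy hyw
      refine periodic_off L F {y | y ∈ L.lattice ∨ y - w ∈ L.lattice} ?_ ?_ ?_ l hl y ?_
      · intro l hl y
        have e : y + l - w = (y - w) + l := by ring
        simp only [Set.mem_ofPred_eq, e]
        rw [mem_add_iff hr hl, mem_add_iff hr hl]
      · intro y hy
        have hy1 : y ∉ L.lattice := fun h => hy (Or.inl h)
        have hy2 : y - w ∉ L.lattice := fun h => hy (Or.inr h)
        have e : y + L.ω₁ - w = (y - w) + L.ω₁ := by ring
        simp only [F, e]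
        rw [dH_per hr L.ω₁_mem_lattice hy1, dH_per hr L.ω₁_mem_lattice hy2]
        have e1 : L.ω₁ = 2 * Real.pi := rfl
        rw [e1, H_add_two_pi, H_add_two_pi]
      · intro y hy
        have hy1 : y ∉ L.lattice := fun h => hy (Or.inl h)
        have hy2 : y - w ∉ L.lattice := fun h => hy (Or.inr h)
        have e : y + L.ω₂ - w = (y - w) + L.ω₂ := by ring
        simp only [F, e]
        rw [dH_per hr L.ω₂_mem_lattice hy1, dH_per hr L.ω₂_mem_lattice hy2]
        have e1 : L.ω₂ = 2 * Complex.I * r := rfl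
        rw [e1, H_add_tau hr hy1, H_add_tau hr hy2]
        ring
      · rintro (h | h)
        · exact hy h
        · exact hyw h
    · intro x
      filter_upwards [eventually_notMem L x, hevw x] with y hy hyw using hFd y hy hyw
    · intro x
      by_cases hx : x ∈ L.lattice
      · exact ⟨-x, neg_mem hx, _, by rw [add_neg_cancel]; exact hlim0⟩
      by_cases hxw : x - w ∈ L.lattice
      · exact ⟨-(x - w), neg_mem hxw, _, by
          have : x + -(x - w) = w := by ring
          rw [this]; exact hlimw⟩
      · exact ⟨0, zero_mem _, F x, by
          rw [add_zero]
          exact (hFd x hx hxw).continuousAt.tendsto.mono_left nhdsWithin_le_nhds⟩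
  obtain ⟨C, hC⟩ := hF
  have hCa : 3 * deriv K 0 = C := tendsto_nhds_unique hlim0 (hC 0)
  rw [hCa]
  exact tendsto_nhds_unique
    ((hFd z hz hzw).continuousAt.tendsto.mono_left nhdsWithin_le_nhds) (hC z)

end kernel

/-- Pseudo-addition identity for the Loewner kernel. -/
theorem pseudo_addition_H (r : ℝ) (hr : 0 < r) (z w : ℂ)
    (hz : z ∉ ThetaLattice r) (hw : w ∉ ThetaLattice r) (hzw : z - w ∉ ThetaLattice r) :
    Hker r (z - w) * (Hker r z - Hker r w) =
      (1 / 2) * Hker r (z - w) ^ 2 + (1 / 2) * (Hker r z - Hker r w) ^ 2 +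
      deriv (Hker r) (z - w) + deriv (Hker r) z + deriv (Hker r) w +
      (6 / (Real.pi : ℂ)) * wzeta r (Real.pi : ℂ) := by
  rw [← mem_PP r hr] at hz hw hzw
  obtain ⟨K, hK, hK0, hloc⟩ := H_local hr
  have h1 := zeta_pi hr K hK hloc
  have h2 := key_identity hr K hK hK0 hloc z w hz hw hzw
  have hpi : (Real.pi : ℂ) ≠ 0 := by exact_mod_cast Real.pi_ne_zero
  have h3 : (6 / (Real.pi : ℂ)) * wzeta r (Real.pi : ℂ) = -3 * deriv K 0 := by
    field_simp
    linear_combination 3 * h1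
  rw [h3]
  linear_combination -h2
end

section
/- Evaluation of ζ_r(π): for every r > 0, ζ_r(π)/(2π) = −Θ‴(r,0)/(6 Θ′(r,0)) = 1/24 − (1/4)·∑_{k=1}^{∞} (sinh(kr))^{−2}. -/
open Complex

section ThetaPart
open Filter Topology Finset

/-- Partial q-Pochhammer product. -/
noncomputable def aq (q : ℝ) (m : ℕ) : ℝ := ∏ k ∈ range m, (1 - q ^ (k + 1))

/-- Inverse of the partial product, extended by zero to negative indices. -/
noncomputable def bq (q : ℝ) (m : ℤ) : ℝ := if 0 ≤ m then (aq q m.toNat)⁻¹ else 0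

lemma one_sub_pos' {q : ℝ} (h0 : 0 < q) (h1 : q < 1) (k : ℕ) : 0 < 1 - q ^ (k + 1) := by
  have := pow_lt_one₀ h0.le h1 (Nat.succ_ne_zero k)
  exact sub_pos.2 this

lemma aq_pos {q : ℝ} (h0 : 0 < q) (h1 : q < 1) (m : ℕ) : 0 < aq q m :=
  prod_pos fun k _ => one_sub_pos' h0 h1 k

lemma aq_succ (q : ℝ) (m : ℕ) : aq q (m + 1) = aq q m * (1 - q ^ (m + 1)) := by
  simp [aq, prod_range_succ]

lemma aq_anti {q : ℝ} (h0 : 0 < q) (h1 : q < 1) : Antitone (aq q) := by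
  refine antitone_nat_of_succ_le fun m => ?_
  rw [aq_succ]
  have := aq_pos h0 h1 m
  have h2 : 0 < q ^ (m + 1) := by positivity
  nlinarith

lemma aq_tendsto {q : ℝ} (h0 : 0 < q) (h1 : q < 1) :
    ∃ L : ℝ, 0 < L ∧ Tendsto (aq q) atTop (𝓝 L) ∧ ∀ m, L ≤ aq q m := by
  have hs : Summable fun n : ℕ => -q ^ (n + 1) := by
    have := (summable_geometric_of_lt_one h0.le h1).mul_left q
    refine (this.congr fun n => ?_).neg
    ring
  have hm : Multipliable fun n : ℕ => 1 + -q ^ (n + 1) :=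
    multipliable_one_add_of_summable hs.norm
  have ht : Tendsto (aq q) atTop (𝓝 (∏' n : ℕ, (1 + -q ^ (n + 1)))) := by
    have := hm.hasProd.tendsto_prod_nat
    refine this.congr fun n => ?_
    simp [aq, sub_eq_add_neg]
  have hne : ∏' n : ℕ, (1 + -q ^ (n + 1)) ≠ 0 := by
    refine tprod_one_add_ne_zero_of_summable (fun n => ?_) hs.norm
    have := one_sub_pos' h0 h1 n
    linarith
  have hle : ∀ m, ∏' n : ℕ, (1 + -q ^ (n + 1)) ≤ aq q m := fun m =>
    (aq_anti h0 h1).le_of_tendsto ht m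
  refine ⟨_, lt_of_le_of_ne ?_ hne.symm, ht, hle⟩
  exact ge_of_tendsto' ht fun m => (aq_pos h0 h1 m).le

lemma bq_step {q : ℝ} (h0 : 0 < q) (h1 : q < 1) (m : ℤ) :
    bq q m = (1 - q ^ (m + 1)) * bq q (m + 1) := by
  unfold bq
  rcases lt_trichotomy m (-1) with h | h | h
  · rw [if_neg (by omega), if_neg (by omega), mul_zero]
  · subst h; simp
  · lift m to ℕ using (by omega)
    rw [if_pos (by omega), if_pos (by omega)]
    have e : ((m : ℤ) + 1).toNat = m + 1 := by omega
    rw [e, Int.toNat_natCast, aq_succ]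
    have := one_sub_pos' h0 h1 m
    have := aq_pos h0 h1 m
    have e2 : q ^ ((m : ℤ) + 1) = q ^ (m + 1) := by exact_mod_cast zpow_natCast q (m + 1)
    rw [e2]
    field_simp

lemma bq_nonneg {q : ℝ} (h0 : 0 < q) (h1 : q < 1) (m : ℤ) : 0 ≤ bq q m := by
  unfold bq
  split_ifs
  · exact (inv_pos.2 (aq_pos h0 h1 _)).le
  · exact le_rfl

lemma bq_tendsto {q L : ℝ} (hL : 0 < L) (h : Tendsto (aq q) atTop (𝓝 L)) :
    Tendsto (bq q) atTop (𝓝 L⁻¹) := by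
  have ht : Tendsto Int.toNat atTop atTop := by
    refine tendsto_atTop.2 fun b => ?_
    filter_upwards [eventually_ge_atTop (b : ℤ)] with x hx
    omega
  refine ((h.comp ht).inv₀ hL.ne').congr' ?_
  filter_upwards [eventually_ge_atTop (0 : ℤ)] with x hx
  simp [bq, hx]

/-- Coefficients of the finite triple product. -/
noncomputable def ee (r : ℝ) (N : ℕ) (n : ℤ) : ℝ :=
  (-1) ^ n * Real.exp (-r * ((n : ℝ) + 1 / 2) ^ 2) * aq (Real.exp (-2 * r)) (2 * N + 1) *
    bq (Real.exp (-2 * r)) (N - n) * bq (Real.exp (-2 * r)) (N + 1 + n)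

lemma exp_zpow (x : ℝ) (n : ℤ) : Real.exp x ^ n = Real.exp (n * x) := by
  rw [mul_comm, Real.exp_mul, Real.rpow_intCast]

lemma g_succ (r : ℝ) (n : ℤ) : Real.exp (-r * (((n + 1 : ℤ) : ℝ) + 1 / 2) ^ 2) =
    Real.exp (-r * ((n : ℝ) + 1 / 2) ^ 2) * Real.exp (-2 * r) ^ (n + 1) := by
  rw [exp_zpow, ← Real.exp_add]
  congr 1
  push_cast
  ring

lemma g_pred (r : ℝ) (n : ℤ) : Real.exp (-r * (((n - 1 : ℤ) : ℝ) + 1 / 2) ^ 2) =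
    Real.exp (-r * ((n : ℝ) + 1 / 2) ^ 2) * Real.exp (-2 * r) ^ (-n) := by
  rw [exp_zpow, ← Real.exp_add]
  congr 1
  push_cast
  ring

lemma ee_step {r : ℝ} (hr : 0 < r) (N : ℕ) (n : ℤ) :
    ee r (N + 1) n = (1 + (Real.exp (-2 * r) ^ (N + 1)) ^ 2) * ee r N n
      - Real.exp (-2 * r) ^ (N + 1) * (ee r N (n - 1) + ee r N (n + 1)) := by
  unfold ee
  rw [g_succ, g_pred]
  set q := Real.exp (-2 * r) with hq
  have h0 : 0 < q := Real.exp_pos _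
  have h1 : q < 1 := by rw [hq, Real.exp_lt_one_iff]; linarith
  have s1 : ((-1 : ℝ)) ^ (n - 1) = - (-1) ^ n := by
    rw [zpow_sub₀ (by norm_num), zpow_one, div_neg, div_one]
  have s2 : ((-1 : ℝ)) ^ (n + 1) = - (-1) ^ n := by
    rw [zpow_add₀ (by norm_num)]; norm_num
  rw [s1, s2]
  have a1 : aq q (2 * (N + 1) + 1) =
      aq q (2 * N + 1) * (1 - q ^ (2 * N + 2)) * (1 - q ^ (2 * N + 3)) := by
    rw [show 2 * (N + 1) + 1 = (2 * N + 1 + 1) + 1 by ring, aq_succ, aq_succ]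
  rw [a1]
  set u : ℤ := (N : ℤ) - n with hu
  set v : ℤ := (N : ℤ) + 1 + n with hv
  have e1 : ((N + 1 : ℕ) : ℤ) - n = u + 1 := by push_cast; omega
  have e2 : ((N + 1 : ℕ) : ℤ) + 1 + n = v + 1 := by push_cast; omega
  have e3 : (N : ℤ) - (n - 1) = u + 1 := by omega
  have e4 : (N : ℤ) + 1 + (n - 1) = v - 1 := by omega
  have e5 : (N : ℤ) - (n + 1) = u - 1 := by omega
  have e6 : (N : ℤ) + 1 + (n + 1) = v + 1 := by omega
  rw [e1, e2, e3, e4, e5, e6]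
  have b1 := bq_step h0 h1 u
  have b2 := bq_step h0 h1 v
  have b3 := bq_step h0 h1 (u - 1)
  have b4 := bq_step h0 h1 (v - 1)
  rw [sub_add_cancel] at b3 b4
  rw [b3, b4, b1, b2]
  have z1 : q ^ u = q ^ N / q ^ n := by rw [hu, zpow_sub₀ h0.ne', zpow_natCast]
  have z2 : q ^ v = q ^ N * q * q ^ n := by
    rw [hv, zpow_add₀ h0.ne', zpow_add₀ h0.ne', zpow_natCast, zpow_one]
  rw [zpow_add₀ h0.ne' u, zpow_add₀ h0.ne' v, zpow_add₀ h0.ne' n, zpow_neg, z1, z2, zpow_one,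
    pow_succ q N, show q ^ (2 * N + 2) = (q ^ N) ^ 2 * q ^ 2 by ring,
    show q ^ (2 * N + 3) = (q ^ N) ^ 2 * q ^ 3 by ring]
  have hX : q ^ n ≠ 0 := (zpow_pos h0 n).ne'
  generalize q ^ n = X at *
  generalize q ^ N = Y at *
  generalize bq q (u + 1) = B1
  generalize bq q (v + 1) = B2
  field_simp
  ring

lemma ee_zero {r : ℝ} (N : ℕ) (n : ℤ) (h : n ∉ Finset.Icc (-(N : ℤ) - 1) N) : ee r N n = 0 := by
  simp only [Finset.mem_Icc, not_and_or] at h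
  unfold ee bq
  rcases h with h | h
  · rw [if_neg (c := 0 ≤ (N : ℤ) + 1 + n) (by omega), mul_zero]
  · rw [if_neg (c := 0 ≤ (N : ℤ) - n) (by omega), mul_zero, zero_mul]

lemma ee_summable (r : ℝ) (N : ℕ) (f : ℤ → ℝ) : Summable fun n => ee r N n * f n :=
  summable_of_ne_finset_zero (s := Finset.Icc (-(N : ℤ) - 1) N)
    fun n hn => by rw [ee_zero N n hn, zero_mul]

lemma ee_moment {r : ℝ} (hr : 0 < r) (N : ℕ) (f : ℤ → ℝ) :
    ∑' n, ee r (N + 1) n * f n = ∑' n, ee r N n *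
      ((1 + (Real.exp (-2 * r) ^ (N + 1)) ^ 2) * f n
        - Real.exp (-2 * r) ^ (N + 1) * (f (n + 1) + f (n - 1))) := by
  set c := Real.exp (-2 * r) ^ (N + 1) with hc
  have h1 : ∑' n, ee r N (n - 1) * f n = ∑' n, ee r N n * f (n + 1) := by
    rw [← (Equiv.addRight (1 : ℤ)).tsum_eq]
    simp
  have h2 : ∑' n, ee r N (n + 1) * f n = ∑' n, ee r N n * f (n - 1) := by
    rw [← (Equiv.subRight (1 : ℤ)).tsum_eq]
    simp
  have s1 : Summable fun n => ee r N (n - 1) * f n := by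
    rw [← (Equiv.addRight (1 : ℤ)).summable_iff]
    simpa [Function.comp_def] using ee_summable r N fun n => f (n + 1)
  have s2 : Summable fun n => ee r N (n + 1) * f n := by
    rw [← (Equiv.subRight (1 : ℤ)).summable_iff]
    simpa [Function.comp_def] using ee_summable r N fun n => f (n - 1)
  have s0 := ee_summable r N f
  have s3 := ee_summable r N fun n => f (n + 1)
  have s4 := ee_summable r N fun n => f (n - 1)
  calc ∑' n, ee r (N + 1) n * f n
      = ∑' n, ((1 + c ^ 2) * (ee r N n * f n)
        - c * (ee r N (n - 1) * f n + ee r N (n + 1) * f n)) := by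
        refine tsum_congr fun n => ?_
        rw [ee_step hr, ← hc]; ring
    _ = (1 + c ^ 2) * ∑' n, ee r N n * f n
        - c * (∑' n, ee r N n * f (n + 1) + ∑' n, ee r N n * f (n - 1)) := by
        rw [Summable.tsum_sub (s0.mul_left _) ((s1.add s2).mul_left _), tsum_mul_left,
          tsum_mul_left, Summable.tsum_add s1 s2, h1, h2]
    _ = _ := by
        rw [← Summable.tsum_add s3 s4, ← tsum_mul_left, ← tsum_mul_left,
          ← Summable.tsum_sub (s0.mul_left _) ((s3.add s4).mul_left _)]
        refine tsum_congr fun n => ?_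
        ring

lemma ee_base (r : ℝ) (hr : 0 < r) (p : ℕ) (hp : Odd p) :
    ∑' n : ℤ, ee r 0 n * (2 * (n : ℝ) + 1) ^ p = 2 * Real.exp (-r / 4) := by
  have h0 : 0 < Real.exp (-2 * r) := Real.exp_pos _
  have h1 : Real.exp (-2 * r) < 1 := by rw [Real.exp_lt_one_iff]; linarith
  rw [tsum_eq_sum (s := {-1, 0}) (fun n hn => by
    rw [ee_zero 0 n, zero_mul]; simp at hn ⊢; omega)]
  rw [Finset.sum_pair (by norm_num)]
  have hq : (1 - Real.exp (-2 * r)) ≠ 0 := by linarith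
  have e1 : (-r * (-1 + 1 / 2) ^ 2 : ℝ) = -r / 4 := by ring
  have e2 : (-r * (0 + 1 / 2) ^ 2 : ℝ) = -r / 4 := by ring
  have e3 : (2 * (-1) + 1 : ℝ) = -1 := by ring
  simp only [ee, bq, aq]
  norm_num [e1, e2, e3, hp.neg_one_pow] 
  rw [show -(r * (1/4)) = -r/4 by ring, mul_assoc, mul_inv_cancel₀ (by simpa using hq)]
  ring

lemma mom1 {r : ℝ} (hr : 0 < r) (N : ℕ) :
    ∑' n : ℤ, ee r (N + 1) n * (2 * (n : ℝ) + 1) =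
      (1 - Real.exp (-2 * r) ^ (N + 1)) ^ 2 * ∑' n : ℤ, ee r N n * (2 * (n : ℝ) + 1) := by
  rw [ee_moment hr, ← tsum_mul_left]
  refine tsum_congr fun n => ?_
  push_cast
  ring

lemma mom3 {r : ℝ} (hr : 0 < r) (N : ℕ) :
    ∑' n : ℤ, ee r (N + 1) n * (2 * (n : ℝ) + 1) ^ 3 =
      (1 - Real.exp (-2 * r) ^ (N + 1)) ^ 2 * ∑' n : ℤ, ee r N n * (2 * (n : ℝ) + 1) ^ 3
      - 24 * Real.exp (-2 * r) ^ (N + 1) * ∑' n : ℤ, ee r N n * (2 * (n : ℝ) + 1) := by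
  rw [ee_moment hr, ← tsum_mul_left, ← tsum_mul_left, ← Summable.tsum_sub]
  · refine tsum_congr fun n => ?_
    push_cast
    ring
  · exact (ee_summable r N _).mul_left _
  · exact (ee_summable r N _).mul_left _

lemma mom1_closed {r : ℝ} (hr : 0 < r) (N : ℕ) :
    ∑' n : ℤ, ee r N n * (2 * (n : ℝ) + 1) =
      2 * Real.exp (-r / 4) * aq (Real.exp (-2 * r)) N ^ 2 := by
  induction N with
  | zero => simpa [aq] using ee_base r hr 1 odd_one
  | succ N ih => rw [mom1 hr, ih, aq_succ]; ring

lemma mom3_closed {r : ℝ} (hr : 0 < r) (N : ℕ) :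
    ∑' n : ℤ, ee r N n * (2 * (n : ℝ) + 1) ^ 3 =
      (1 - 24 * ∑ k ∈ range N, Real.exp (-2 * r) ^ (k + 1) / (1 - Real.exp (-2 * r) ^ (k + 1)) ^ 2)
       * (2 * Real.exp (-r / 4) * aq (Real.exp (-2 * r)) N ^ 2) := by
  induction N with
  | zero => simpa [aq] using ee_base r hr 3 (by decide)
  | succ N ih =>
    rw [mom3 hr, ih, mom1_closed hr, aq_succ, Finset.sum_range_succ]
    have h0 : 0 < Real.exp (-2 * r) := Real.exp_pos _
    have h1 : Real.exp (-2 * r) < 1 := by rw [Real.exp_lt_one_iff]; linarith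
    have := (one_sub_pos' h0 h1 N).ne'
    generalize (∑ k ∈ range N, Real.exp (-2 * r) ^ (k + 1) / (1 - Real.exp (-2 * r) ^ (k + 1)) ^ 2)
      = S
    generalize Real.exp (-2 * r) ^ (N + 1) = Q at *
    field_simp
    ring

lemma theta_bound_summable {r : ℝ} (hr : 0 < r) (R : ℝ) (p : ℕ) :
    Summable fun n : ℤ => Real.exp (-r * ((n : ℝ) + 1 / 2) ^ 2) * |(n : ℝ) + 1 / 2| ^ p *
      Real.exp (R * |(n : ℝ) + 1 / 2|) := by
  have hs := summable_pow_mul_jacobiTheta₂_term_bound ((r + |R| + 1) / (2 * Real.pi))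
    (T := r / Real.pi) (by positivity) 0
  refine (hs.mul_left ((p.factorial : ℝ) * Real.exp ((|R| + 1) / 2))).of_norm_bounded fun n => ?_
  rw [Real.norm_of_nonneg (by positivity), pow_zero, one_mul]
  set x := |(n : ℝ) + 1 / 2| with hx
  have hx0 : 0 ≤ x := abs_nonneg _
  have hp : x ^ p ≤ (p.factorial : ℝ) * Real.exp x := by
    have := Real.pow_div_factorial_le_exp x hx0 p
    rw [div_le_iff₀ (by positivity)] at this
    linarith
  have hxn : x ≤ |(n : ℝ)| + 1 / 2 := by
    have := abs_add_le (n : ℝ) (1 / 2)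
    rwa [abs_of_pos (by norm_num : (0 : ℝ) < 1 / 2)] at this
  have hsq : (n : ℝ) ^ 2 - |(n : ℝ)| ≤ ((n : ℝ) + 1 / 2) ^ 2 := by
    have := neg_abs_le (n : ℝ)
    nlinarith
  calc _ ≤ Real.exp (-r * ((n : ℝ) + 1 / 2) ^ 2) * ((p.factorial : ℝ) * Real.exp x) *
        Real.exp (R * x) := by gcongr
    _ = (p.factorial : ℝ) * Real.exp (-r * ((n : ℝ) + 1 / 2) ^ 2 + x + R * x) := by
        rw [Real.exp_add, Real.exp_add]; ring
    _ ≤ (p.factorial : ℝ) * Real.exp ((|R| + 1) / 2 +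
        -Real.pi * (r / Real.pi * (n : ℝ) ^ 2 - 2 * ((r + |R| + 1) / (2 * Real.pi)) * |(n : ℝ)|)) := by
        refine mul_le_mul_of_nonneg_left (Real.exp_le_exp.2 ?_) (by positivity)
        have e : -Real.pi * (r / Real.pi * (n : ℝ) ^ 2 - 2 * ((r + |R| + 1) / (2 * Real.pi)) * |(n : ℝ)|)
            = -r * (n : ℝ) ^ 2 + (r + |R| + 1) * |(n : ℝ)| := by
          field_simp
          ring
        rw [e]
        have h1 : R * x ≤ |R| * x := by gcongr; exact le_abs_self R
        have h2 : (|R| + 1) * x ≤ (|R| + 1) * (|(n : ℝ)| + 1 / 2) := by gcongr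
        have h3 := mul_le_mul_of_nonneg_left hsq hr.le
        linarith
    _ = _ := by rw [Real.exp_add, Int.cast_abs]; ring

lemma mom_tendsto {r : ℝ} (hr : 0 < r) {L : ℝ} (hL : 0 < L)
    (ht : Tendsto (aq (Real.exp (-2 * r))) atTop (𝓝 L)) (hle : ∀ m, L ≤ aq (Real.exp (-2 * r)) m)
    (p : ℕ) :
    Tendsto (fun N => ∑' n : ℤ, ee r N n * (2 * (n : ℝ) + 1) ^ p) atTop
      (𝓝 (L⁻¹ * ∑' n : ℤ, (-1) ^ n * Real.exp (-r * ((n : ℝ) + 1 / 2) ^ 2) *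
        (2 * (n : ℝ) + 1) ^ p)) := by
  have h0 : 0 < Real.exp (-2 * r) := Real.exp_pos _
  have h1 : Real.exp (-2 * r) < 1 := by rw [Real.exp_lt_one_iff]; linarith
  rw [← tsum_mul_left]
  have hb := bq_tendsto hL ht
  have hs := ((theta_bound_summable hr 0 p).mul_left (2 ^ p)).mul_left (L⁻¹ * L⁻¹)
  refine tendsto_tsum_of_dominated_convergence hs (fun n => ?_) (Eventually.of_forall fun N n => ?_)
  · have t1 : Tendsto (fun N : ℕ => aq (Real.exp (-2 * r)) (2 * N + 1)) atTop (𝓝 L) :=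
      ht.comp (tendsto_atTop_mono (fun N => by simp; omega) tendsto_id)
    have t2 : Tendsto (fun N : ℕ => bq (Real.exp (-2 * r)) (N - n)) atTop (𝓝 L⁻¹) :=
      hb.comp (tendsto_atTop_add_const_right _ (-n) tendsto_natCast_atTop_atTop)
    have t3 : Tendsto (fun N : ℕ => bq (Real.exp (-2 * r)) (N + 1 + n)) atTop (𝓝 L⁻¹) :=
      hb.comp (tendsto_atTop_add_const_right _ n
        (tendsto_atTop_add_const_right _ 1 tendsto_natCast_atTop_atTop))
    have := ((((t1.const_mul ((-1) ^ n * Real.exp (-r * ((n : ℝ) + 1 / 2) ^ 2))).mul t2).mul t3).mul_const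
      ((2 * (n : ℝ) + 1) ^ p))
    have hv : (-1) ^ n * Real.exp (-r * ((n : ℝ) + 1 / 2) ^ 2) * L * L⁻¹ * L⁻¹ * (2 * (n : ℝ) + 1) ^ p
        = L⁻¹ * ((-1) ^ n * Real.exp (-r * ((n : ℝ) + 1 / 2) ^ 2) * (2 * (n : ℝ) + 1) ^ p) := by
      field_simp
    rw [hv] at this
    exact this
  · have hbb : ∀ m, bq (Real.exp (-2 * r)) m ≤ L⁻¹ := fun m => by
      unfold bq
      split_ifs
      · exact inv_anti₀ hL (hle _)
      · positivity
    have ha : aq (Real.exp (-2 * r)) (2 * N + 1) ≤ 1 := by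
      simpa [aq] using aq_anti h0 h1 (Nat.zero_le (2 * N + 1))
    have e : |2 * (n : ℝ) + 1| = 2 * |(n : ℝ) + 1 / 2| := by
      rw [show 2 * (n : ℝ) + 1 = 2 * ((n : ℝ) + 1 / 2) by ring, abs_mul]; norm_num
    have hb1 := bq_nonneg h0 h1 (N - n)
    have hb2 := bq_nonneg h0 h1 (N + 1 + n)
    have ha0 := (aq_pos h0 h1 (2 * N + 1)).le
    have habs : |((-1 : ℝ)) ^ n| = 1 := by simp [abs_zpow]
    rw [Real.norm_eq_abs, abs_mul, abs_pow, e, ee, abs_mul, abs_mul, abs_mul, abs_mul,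
      abs_of_nonneg hb1, abs_of_nonneg hb2, abs_of_nonneg ha0, habs, abs_of_pos (Real.exp_pos _),
      one_mul, zero_mul, Real.exp_zero, mul_one, mul_pow]
    have k1 : aq (Real.exp (-2 * r)) (2 * N + 1) * bq (Real.exp (-2 * r)) (N - n) *
        bq (Real.exp (-2 * r)) (N + 1 + n) ≤ 1 * L⁻¹ * L⁻¹ := by
      gcongr
      · exact hbb _
      · exact hbb _
    have k2 : 0 ≤ Real.exp (-r * ((n : ℝ) + 1 / 2) ^ 2) * (2 ^ p * |(n : ℝ) + 1 / 2| ^ p) := by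
      positivity
    have := mul_le_mul_of_nonneg_left k1 k2
    linarith

lemma hterm_lemma {r : ℝ} (hr : 0 < r) (k : ℕ) :
    Real.exp (-2 * r) ^ (k + 1) / (1 - Real.exp (-2 * r) ^ (k + 1)) ^ 2
      = (1 / 4) * (1 / Real.sinh ((k + 1) * r) ^ 2) := by
  have hx : 0 < ((k : ℝ) + 1) * r := by positivity
  have hs : 0 < Real.sinh ((k + 1) * r) := Real.sinh_pos_iff.2 hx
  have e : Real.exp (-2 * r) ^ (k + 1) = Real.exp (-((k + 1) * r)) ^ 2 := by
    rw [← Real.exp_nat_mul, ← Real.exp_nat_mul]; congr 1; push_cast; ring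
  have e2 : Real.exp ((k + 1) * r) * Real.exp (-((k + 1) * r)) = 1 := by
    rw [← Real.exp_add]; simp
  have e3 : 1 - Real.exp (-2 * r) ^ (k + 1)
      = 2 * Real.exp (-((k + 1) * r)) * Real.sinh ((k + 1) * r) := by
    rw [Real.sinh_eq, e]; linear_combination -e2
  rw [e3, e]
  have := (Real.exp_pos (-((k + 1) * r))).ne'
  field_simp
  norm_num

lemma theta_ratio {r : ℝ} (hr : 0 < r) :
    ∃ S : ℝ, HasSum (fun k : ℕ => 1 / Real.sinh ((k + 1) * r) ^ 2) S ∧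
    (∑' n : ℤ, (-1) ^ n * Real.exp (-r * ((n : ℝ) + 1 / 2) ^ 2) * (2 * (n : ℝ) + 1)) ≠ 0 ∧
    (∑' n : ℤ, (-1) ^ n * Real.exp (-r * ((n : ℝ) + 1 / 2) ^ 2) * (2 * (n : ℝ) + 1) ^ 3) =
    (1 - 6 * S) *
    (∑' n : ℤ, (-1) ^ n * Real.exp (-r * ((n : ℝ) + 1 / 2) ^ 2) * (2 * (n : ℝ) + 1)) := by
  have h0 : 0 < Real.exp (-2 * r) := Real.exp_pos _
  have h1 : Real.exp (-2 * r) < 1 := by rw [Real.exp_lt_one_iff]; linarith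
  obtain ⟨L, hL, ht, hle⟩ := aq_tendsto h0 h1
  have T1 := mom_tendsto hr hL ht hle 1
  have T3 := mom_tendsto hr hL ht hle 3
  simp only [pow_one, mom1_closed hr] at T1
  simp only [mom3_closed hr] at T3
  set A := ∑' n : ℤ, (-1) ^ n * Real.exp (-r * ((n : ℝ) + 1 / 2) ^ 2) * (2 * (n : ℝ) + 1)
  set B := ∑' n : ℤ, (-1) ^ n * Real.exp (-r * ((n : ℝ) + 1 / 2) ^ 2) * (2 * (n : ℝ) + 1) ^ 3
  have U1 := tendsto_nhds_unique T1 ((ht.pow 2).const_mul (2 * Real.exp (-r / 4)))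
  have hA : A ≠ 0 := by
    rintro hA
    rw [hA, mul_zero] at U1
    have : 0 < 2 * Real.exp (-r / 4) * L ^ 2 := by positivity
    linarith
  have hc : L⁻¹ * A ≠ 0 := mul_ne_zero (inv_ne_zero hL.ne') hA
  have hterm := hterm_lemma hr
  have T4 := T3.div T1 hc
  have T5 : Tendsto (fun N => 1 - 6 * ∑ k ∈ range N, 1 / Real.sinh ((k + 1) * r) ^ 2) atTop
      (𝓝 (L⁻¹ * B / (L⁻¹ * A))) := by
    refine T4.congr fun N => ?_
    have := (aq_pos h0 h1 N).ne'
    rw [Pi.div_apply, mul_div_assoc, div_self (by positivity), mul_one,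
      Finset.sum_congr rfl fun k _ => hterm k, ← Finset.mul_sum]
    ring
  have T6 : Tendsto (fun N => ∑ k ∈ range N, 1 / Real.sinh ((k + 1) * r) ^ 2) atTop
      (𝓝 ((1 - L⁻¹ * B / (L⁻¹ * A)) / 6)) := by
    refine ((T5.const_sub 1).div_const 6).congr fun N => ?_
    ring
  refine ⟨_, (hasSum_iff_tendsto_nat_of_nonneg (fun k => by positivity) _).2 T6, hA, ?_⟩
  field_simp
  ring

/-- The k-th derivative series of theta. -/
noncomputable def thetaD (r : ℝ) (k : ℕ) (z : ℂ) : ℂ :=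
  ∑' n : ℤ, (-1 : ℂ) ^ n * Complex.exp (-(r : ℂ) * ((n : ℂ) + 1 / 2) ^ 2) *
    (((n : ℂ) + 1 / 2) * Complex.I) ^ k * Complex.exp (((n : ℂ) + 1 / 2) * Complex.I * z)

lemma thetaD_term_norm (r : ℝ) (k : ℕ) (R : ℝ) (z : ℂ) (hz : ‖z‖ ≤ R) (n : ℤ) :
    ‖(-1 : ℂ) ^ n * Complex.exp (-(r : ℂ) * ((n : ℂ) + 1 / 2) ^ 2) *
    (((n : ℂ) + 1 / 2) * Complex.I) ^ k * Complex.exp (((n : ℂ) + 1 / 2) * Complex.I * z)‖ ≤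
    Real.exp (-r * ((n : ℝ) + 1 / 2) ^ 2) * |(n : ℝ) + 1 / 2| ^ k *
      Real.exp (R * |(n : ℝ) + 1 / 2|) := by
  have e : ((n : ℂ) + 1 / 2) = (((n : ℝ) + 1 / 2 : ℝ) : ℂ) := by push_cast; rfl
  have e1 : Complex.exp (-(r : ℂ) * ((n : ℂ) + 1 / 2) ^ 2)
      = ((Real.exp (-r * ((n : ℝ) + 1 / 2) ^ 2) : ℝ) : ℂ) := by push_cast; rfl
  rw [e1, e, norm_mul, norm_mul, norm_mul, norm_zpow, norm_neg, norm_one, one_zpow, one_mul,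
    norm_pow, norm_mul, Complex.norm_I, mul_one, Complex.norm_real, Complex.norm_real,
    Real.norm_eq_abs, Real.norm_eq_abs, abs_of_pos (Real.exp_pos _)]
  gcongr
  rw [Complex.norm_exp, Real.exp_le_exp]
  refine (Complex.re_le_norm _).trans ?_
  rw [norm_mul, norm_mul, Complex.norm_I, mul_one, Complex.norm_real, Real.norm_eq_abs, mul_comm]
  gcongr

lemma thetaD_hasDerivAt {r : ℝ} (hr : 0 < r) (k : ℕ) (z : ℂ) :
    HasDerivAt (thetaD r k) (thetaD r (k + 1) z) z := by
  unfold thetaD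
  refine hasDerivAt_tsum_of_isPreconnected (t := Metric.ball 0 (‖z‖ + 1)) (y₀ := z)
    (theta_bound_summable hr (‖z‖ + 1) (k + 1)) Metric.isOpen_ball
    (convex_ball _ _).isPreconnected (fun n y _ => ?_)
    (fun n y hy => thetaD_term_norm r (k + 1) _ y ?_ n) ?_ ?_ ?_
  · have h := ((hasDerivAt_id y).const_mul (((n : ℂ) + 1 / 2) * Complex.I)).cexp
    have h2 := h.const_mul ((-1 : ℂ) ^ n * Complex.exp (-(r : ℂ) * ((n : ℂ) + 1 / 2) ^ 2) *
      (((n : ℂ) + 1 / 2) * Complex.I) ^ k)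
    refine h2.congr_deriv ?_
    simp only [id]
    ring
  · rw [mem_ball_zero_iff] at hy
    exact hy.le
  · simp
  · exact (theta_bound_summable hr ‖z‖ k).of_norm_bounded fun n =>
      thetaD_term_norm r k _ z le_rfl n
  · simp

lemma Theta_eq_s4 (r : ℝ) : Theta r = fun z => (1 / Complex.I) * thetaD r 0 z := by
  ext z
  simp [Theta, thetaD]

lemma Theta_deriv {r : ℝ} (hr : 0 < r) :
    deriv (Theta r) = fun z => (1 / Complex.I) * thetaD r 1 z := by
  rw [Theta_eq_s4]
  ext z
  exact ((thetaD_hasDerivAt hr 0 z).const_mul _).deriv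

lemma Theta_deriv3 {r : ℝ} (hr : 0 < r) :
    iteratedDeriv 3 (Theta r) = fun z => (1 / Complex.I) * thetaD r 3 z := by
  have h : ∀ k, deriv (fun z => (1 / Complex.I) * thetaD r k z)
      = fun z => (1 / Complex.I) * thetaD r (k + 1) z := fun k => by
    ext z
    exact ((thetaD_hasDerivAt hr k z).const_mul _).deriv
  rw [iteratedDeriv_succ, iteratedDeriv_succ, iteratedDeriv_one, Theta_deriv hr, h, h]

lemma thetaD_zero (r : ℝ) (k : ℕ) : thetaD r k 0 = (Complex.I / 2) ^ k *
    ((∑' n : ℤ, (-1) ^ n * Real.exp (-r * ((n : ℝ) + 1 / 2) ^ 2) * (2 * (n : ℝ) + 1) ^ k : ℝ) : ℂ) := by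
  rw [Complex.ofReal_tsum, ← tsum_mul_left, thetaD]
  refine tsum_congr fun n => ?_
  push_cast
  rw [mul_zero, Complex.exp_zero, show ((n : ℂ) + 1 / 2) * Complex.I
    = (Complex.I / 2) * (2 * n + 1) by ring, mul_pow]
  ring

lemma theta_final {r : ℝ} (hr : 0 < r) :
    Summable (fun k : ℕ => 1 / Real.sinh ((k + 1) * r) ^ 2) ∧
    -iteratedDeriv 3 (Theta r) 0 / (6 * deriv (Theta r) 0) =
      1 / 24 - (1 / 4) * ∑' k : ℕ, ((1 / Real.sinh ((k + 1) * r) ^ 2 : ℝ) : ℂ) := by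
  obtain ⟨S, hS, hA, hB⟩ := theta_ratio hr
  refine ⟨hS.summable, ?_⟩
  rw [← Complex.ofReal_tsum, hS.tsum_eq, Theta_deriv hr, Theta_deriv3 hr]
  simp only [thetaD_zero, pow_one, hB]
  generalize (∑' n : ℤ, (-1) ^ n * Real.exp (-r * ((n : ℝ) + 1 / 2) ^ 2) * (2 * (n : ℝ) + 1)) = A at *
  have hA' : (A : ℂ) ≠ 0 := by exact_mod_cast hA
  have hI := Complex.I_ne_zero
  push_cast
  have h2 : (Complex.I / 2) ^ 3 = -(1 / 4) * (Complex.I / 2) := by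
    rw [div_pow, pow_succ, Complex.I_sq]; ring
  rw [h2]
  field_simp
  ring

end ThetaPart

section ZetaPart

open Filter Topology Finset SummationFilter

lemma tendsto_inv_nat_add (c : ℂ) : Tendsto (fun N : ℕ => ((N : ℂ) + c)⁻¹) atTop (𝓝 0) := by
  refine tendsto_inv₀_cobounded.comp ?_
  refine (tendsto_add_const_cobounded c).comp ?_
  rw [← tendsto_norm_atTop_iff_cobounded]
  simpa using tendsto_natCast_atTop_atTop

lemma telescope_hasSum (c : ℂ)
    (hs : Summable fun m : ℤ => ((m : ℂ) + c + 1)⁻¹ - ((m : ℂ) + c)⁻¹) :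
    HasSum (fun m : ℤ => ((m : ℂ) + c + 1)⁻¹ - ((m : ℂ) + c)⁻¹) 0 := by
  have h1 := hs.hasSum
  have h2 : HasSum (fun m : ℤ => ((m : ℂ) + c + 1)⁻¹ - ((m : ℂ) + c)⁻¹) 
      (∑' m : ℤ, (((m : ℂ) + c + 1)⁻¹ - ((m : ℂ) + c)⁻¹)) (symmetricIco ℤ) := 
    h1.mono_left (symmetricIco ℤ).le_atTop
  rw [hasSum_symmetricIco_int_iff] at h2
  have h3 : Tendsto (fun N : ℕ => ∑ m ∈ Ico (-N : ℤ) N, (((m : ℂ) + c + 1)⁻¹ - ((m : ℂ) + c)⁻¹))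
      atTop (𝓝 0) := by
    have e : ∀ N : ℕ, ∑ m ∈ Ico (-N : ℤ) N, (((m : ℂ) + c + 1)⁻¹ - ((m : ℂ) + c)⁻¹)
        = ((N : ℂ) + c)⁻¹ + ((N : ℂ) + (-c))⁻¹ := by
      intro N
      have := sum_Ico_int_sub N (fun m : ℤ => -((m : ℂ) + c)⁻¹)
      rw [show ((N : ℂ) + (-c))⁻¹ = -(-(N : ℂ) + c)⁻¹ by rw [← inv_neg]; congr 1; ring]
      push_cast at this
      rw [add_comm, ← sub_neg_eq_add, ← this]
      refine sum_congr rfl fun m _ => ?_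
      rw [show (m : ℂ) + 1 + c = m + c + 1 by ring]
      ring
    simp_rw [e]
    simpa using (tendsto_inv_nat_add c).add (tendsto_inv_nat_add (-c))
  rw [tendsto_nhds_unique h2 h3] at h1
  exact h1

/-- The point i r / π in the upper half plane. -/
noncomputable def tauPt (r : ℝ) (hr : 0 < r) : UpperHalfPlane :=
  ⟨Complex.I * r / Real.pi, by
    rw [mul_div_assoc, ← Complex.ofReal_div, Complex.I_mul_im, Complex.ofReal_re]
    positivity⟩

lemma tauPt_coe (r : ℝ) (hr : 0 < r) : (tauPt r hr : ℂ) = Complex.I * r / Real.pi := rfl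

lemma latPt_eq (r : ℝ) (hr : 0 < r) (p : ℤ × ℤ) :
    latPt r p = 2 * Real.pi * ((p.2 : ℂ) * tauPt r hr + p.1) := by
  have : (Real.pi : ℂ) ≠ 0 := by exact_mod_cast Real.pi_ne_zero
  rw [latPt, tauPt_coe]
  field_simp
  ring

lemma lin_ne (z : UpperHalfPlane) (a b : ℤ) (h : a ≠ 0 ∨ b ≠ 0) : (a : ℂ) * z + b ≠ 0 := by
  have := UpperHalfPlane.linear_ne_zero z (cd := ![(a : ℝ), b]) (by
    intro h0
    have h1 := congrFun h0 0
    have h2 := congrFun h0 1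
    simp at h1 h2
    tauto)
  simpa using this

/-- The summand of the Weierstrass zeta function at π. -/
noncomputable def fw (r : ℝ) (p : ℤ × ℤ) : ℂ := if p = 0 then 0 else
    (1 / (Real.pi - latPt r p) + 1 / latPt r p + Real.pi / latPt r p ^ 2)

lemma odd_ne (z : UpperHalfPlane) (p : ℤ × ℤ) : 1 - 2 * ((p.2 : ℂ) * z + p.1) ≠ 0 := by
  have := lin_ne z (-2 * p.2) (1 - 2 * p.1) (by omega)
  push_cast at this
  intro h
  apply this
  rw [← h]; ring

lemma fw_eq (r : ℝ) (hr : 0 < r) (p : ℤ × ℤ) :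
    fw r p = (1 / Real.pi) * (((2 * ((p.2 : ℂ) * tauPt r hr + p.1)) ^ 2 *
      (1 - 2 * ((p.2 : ℂ) * tauPt r hr + p.1)))⁻¹) := by
  have hpi : (Real.pi : ℂ) ≠ 0 := by exact_mod_cast Real.pi_ne_zero
  unfold fw
  split_ifs with h
  · simp [h]
  · have h1 := lin_ne (tauPt r hr) p.2 p.1 (by
      by_contra! h2
      exact h (Prod.ext h2.2 h2.1))
    have h2 := odd_ne (tauPt r hr) p
    rw [latPt_eq r hr]
    generalize (p.2 : ℂ) * tauPt r hr + p.1 = w at *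
    rw [show (Real.pi : ℂ) - 2 * Real.pi * w = Real.pi * (1 - 2 * w) by ring]
    field_simp
    ring

lemma fw_summable (r : ℝ) (hr : 0 < r) : Summable (fw r) := by
  have H : Summable fun m : Fin 2 → ℤ => (((m 0 : ℂ) * tauPt r hr + m 1) ^ 2 *
      (m 0 * tauPt r hr + m 1 + 1))⁻¹ := by
    apply EisensteinSeries.summable_of_isBigO_rpow_norm (a := 3) (by linarith)
    simpa [pow_three, pow_two, ← mul_assoc] using
      ((EisensteinSeries.isBigO_linear_add_const_vec (tauPt r hr) 0 1).mul
      (EisensteinSeries.isBigO_linear_add_const_vec (tauPt r hr) 0 0)).mul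
      (EisensteinSeries.isBigO_linear_add_const_vec (tauPt r hr) 0 0)
  have hi : Function.Injective (fun p : ℤ × ℤ => ![-2 * p.2, -2 * p.1]) := by
    intro p q h
    have h1 := congrFun h 0
    have h2 := congrFun h 1
    simp at h1 h2
    exact Prod.ext h2 h1
  refine ((H.comp_injective hi).mul_left (1 / (Real.pi : ℂ))).congr fun p => ?_
  rw [fw_eq r hr]
  simp only [Function.comp, Matrix.cons_val_zero, Matrix.cons_val_one]
  push_cast
  congr 2
  ring

/-- The symmetrized summand. -/
noncomputable def Hw (z : UpperHalfPlane) (n m : ℤ) : ℂ :=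
  (1 / (2 * Real.pi)) * ((((m : ℂ) + (n * z - 1 / 2) + 1)⁻¹ - ((m : ℂ) + (n * z - 1 / 2))⁻¹)
    + EisensteinSeries.eisSummand 2 ![n, m] z)

lemma fw_symm (r : ℝ) (hr : 0 < r) (p : ℤ × ℤ) :
    fw r p + fw r (-p) = Hw (tauPt r hr) p.2 p.1 - if p = 0 then 2 / (Real.pi : ℂ) else 0 := by
  have hpi : (Real.pi : ℂ) ≠ 0 := by exact_mod_cast Real.pi_ne_zero
  rw [fw_eq r hr, fw_eq r hr, Hw, EisensteinSeries.eisSummand]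
  simp only [Matrix.cons_val_zero, Matrix.cons_val_one, Prod.fst_neg, Prod.snd_neg]
  split_ifs with h
  · subst h
    simp
    field_simp
    norm_num
  · have h1 := lin_ne (tauPt r hr) p.2 p.1 (by
      by_contra! h2
      exact h (Prod.ext h2.2 h2.1))
    have h2 := odd_ne (tauPt r hr) p
    have h3 := odd_ne (tauPt r hr) (-p)
    simp only [Prod.fst_neg, Prod.snd_neg] at h3
    push_cast at h3 ⊢
    rw [show -(p.2 : ℂ) * tauPt r hr + -(p.1 : ℂ) = -(p.2 * tauPt r hr + p.1) by ring] at h3 ⊢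
    rw [show (p.1 : ℂ) + (p.2 * tauPt r hr - 1 / 2) + 1 = (1 - 2 * (-(p.2 * tauPt r hr + p.1))) / 2
      by ring, show (p.1 : ℂ) + (p.2 * tauPt r hr - 1 / 2) = -(1 - 2 * (p.2 * tauPt r hr + p.1)) / 2
      by ring, zpow_neg, zpow_ofNat]
    generalize (p.2 : ℂ) * tauPt r hr + p.1 = w at *
    rw [show 1 - 2 * -w = 1 + 2 * w by ring] at h3 ⊢
    field_simp
    ring

lemma hasSum_neg_pair {f : ℤ × ℤ → ℂ} {a : ℂ} (h : HasSum f a) : HasSum (fun p => f (-p)) a :=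
  (Equiv.hasSum_iff (f := f) (Equiv.neg (ℤ × ℤ))).2 h

lemma hasSum_swap_pair {f : ℤ → ℤ → ℂ} {a : ℂ} (h : HasSum (fun p : ℤ × ℤ => f p.2 p.1) a) :
    HasSum (fun p : ℤ × ℤ => f p.1 p.2) a :=
  (Equiv.hasSum_iff (f := fun p : ℤ × ℤ => f p.2 p.1) (Equiv.prodComm ℤ ℤ)).2 h

lemma Hw_hasSum (r : ℝ) (hr : 0 < r) :
    HasSum (fun p : ℤ × ℤ => Hw (tauPt r hr) p.1 p.2)
      ((∑' p, fw r p) + (∑' p, fw r p) + 2 / Real.pi) := by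
  have hf := (fw_summable r hr).hasSum
  have hf' : HasSum (fun p => fw r (-p)) (∑' p, fw r p) :=
    hasSum_neg_pair hf
  have hH : HasSum (fun p : ℤ × ℤ => Hw (tauPt r hr) p.2 p.1)
      ((∑' p, fw r p) + (∑' p, fw r p) + 2 / Real.pi) := by
    have h0 : HasSum (fun p : ℤ × ℤ => if p = 0 then 2 / (Real.pi : ℂ) else 0)
        (2 / (Real.pi : ℂ)) := by
      have := hasSum_single (f := fun p : ℤ × ℤ => if p = 0 then 2 / (Real.pi : ℂ) else 0) 0
        (fun p hp => if_neg hp)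
      rwa [if_pos rfl] at this
    have h := (hf.add hf').add h0
    have e : (fun p : ℤ × ℤ => Hw (tauPt r hr) p.2 p.1) =
        fun p => fw r p + fw r (-p) + if p = 0 then 2 / (Real.pi : ℂ) else 0 := by
      funext p
      rw [fw_symm r hr, sub_add_cancel]
    rw [e]
    exact h
  exact hasSum_swap_pair hH

lemma Hw_row (z : UpperHalfPlane) (n : ℤ) (s1 : Summable (fun m => Hw z n m)) :
    HasSum (fun m => Hw z n m) ((1 / (2 * Real.pi)) * EisensteinSeries.e2Summand n z) := by
  have hpi : (Real.pi : ℂ) ≠ 0 := by exact_mod_cast Real.pi_ne_zero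
  have s2 := EisensteinSeries.e2Summand_summable n z
  have s3 := (s1.mul_left (2 * Real.pi : ℂ)).sub s2
  have s4 := telescope_hasSum (n * z - 1 / 2) (s3.congr fun m => by
    unfold Hw
    rw [← mul_assoc, mul_one_div_cancel (by simp), one_mul, add_sub_cancel_right])
  have := (s4.add s2.hasSum).mul_left (1 / (2 * Real.pi : ℂ))
  rw [zero_add] at this
  exact this

lemma wzeta_eq_fw (r : ℝ) : wzeta r Real.pi = 1 / Real.pi + ∑' p, fw r p := by
  simp only [wzeta, fw]

lemma wzeta_G2 (r : ℝ) (hr : 0 < r) :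
    wzeta r Real.pi = (1 / (4 * Real.pi)) * EisensteinSeries.G2 (tauPt r hr) := by
  have hH2 := Hw_hasSum r hr
  have h1 := hH2.prod_fiberwise (fun n => Hw_row (tauPt r hr) n (hH2.summable.prod_factor n))
  have h2 : HasSum (fun n => (1 / (2 * Real.pi : ℂ)) * EisensteinSeries.e2Summand n (tauPt r hr))
      ((∑' p, fw r p) + (∑' p, fw r p) + 2 / Real.pi) (symmetricIcc ℤ) :=
    h1.mono_left (symmetricIcc ℤ).le_atTop
  have h3 := (EisensteinSeries.hasSum_e2Summand_symmetricIcc (tauPt r hr)).mul_left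
    (1 / (2 * Real.pi : ℂ))
  rw [← EisensteinSeries.G2_eq_tsum_cexp] at h3
  have h4 := h2.unique h3
  rw [wzeta_eq_fw]
  linear_combination (1 / 2) * h4

lemma wzeta_final (r : ℝ) (hr : 0 < r) :
    wzeta r (Real.pi : ℂ) / (2 * (Real.pi : ℂ)) =
      1 / 24 - (1 / 4) *
        ∑' k : ℕ, ((1 / Real.sinh ((k + 1) * r) ^ 2 : ℝ) : ℂ) := by
  have hpi : (Real.pi : ℂ) ≠ 0 := by exact_mod_cast Real.pi_ne_zero
  have hq : Complex.exp (2 * Real.pi * Complex.I * (tauPt r hr : ℂ)) = (Real.exp (-2 * r) : ℝ) := by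
    rw [tauPt_coe, Complex.ofReal_exp]
    congr 1
    push_cast
    field_simp
    rw [Complex.I_sq]; ring
  have hlt : ‖((Real.exp (-2 * r) : ℝ) : ℂ)‖ < 1 := by
    rw [Complex.norm_real, Real.norm_of_nonneg (Real.exp_pos _).le, Real.exp_lt_one_iff]
    linarith
  rw [wzeta_G2 r hr, EisensteinSeries.G2_eq_tsum_cexp, riemannZeta_two, hq,
    ← tsum_prod_pow_eq_tsum_sigma 1 hlt,
    tsum_pnat_eq_tsum_succ (f := fun d => ∑' c : ℕ+, (c : ℂ) ^ 1 *
      ((Real.exp (-2 * r) : ℝ) : ℂ) ^ (d * c : ℕ))]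
  have key : ∀ k : ℕ, ∑' c : ℕ+, (c : ℂ) ^ 1 * ((Real.exp (-2 * r) : ℝ) : ℂ) ^ ((k + 1) * c : ℕ)
      = (1 / 4) * ((1 / Real.sinh ((k + 1) * r) ^ 2 : ℝ) : ℂ) := by
    intro k
    have ht := congrArg (fun x : ℝ => (x : ℂ)) (hterm_lemma hr k)
    simp only [Complex.ofReal_mul, Complex.ofReal_div, Complex.ofReal_pow, Complex.ofReal_sub,
      Complex.ofReal_one, Complex.ofReal_ofNat] at ht ⊢
    rw [← ht]
    have hlt' : ‖((Real.exp (-2 * r) : ℝ) : ℂ) ^ (k + 1)‖ < 1 := by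
      rw [norm_pow]; exact pow_lt_one₀ (norm_nonneg _) hlt (Nat.succ_ne_zero k)
    have h := tsum_coe_mul_geometric_of_norm_lt_one hlt'
    have hsm := (hasSum_coe_mul_geometric_of_norm_lt_one hlt').summable
    rw [← h, ← tsum_zero_pnat_eq_tsum_nat hsm]
    simp only [Nat.cast_zero, zero_mul, zero_add, pow_one, pow_mul]
  simp_rw [key, tsum_mul_left]
  generalize (∑' k : ℕ, ((1 / Real.sinh ((k + 1) * r) ^ 2 : ℝ) : ℂ)) = S
  field_simp
  ring

end ZetaPart

theorem wzeta_pi_eval (r : ℝ) (hr : 0 < r) :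
    wzeta r (Real.pi : ℂ) / (2 * (Real.pi : ℂ)) =
      -iteratedDeriv 3 (Theta r) 0 / (6 * deriv (Theta r) 0) ∧
    wzeta r (Real.pi : ℂ) / (2 * (Real.pi : ℂ)) =
      1 / 24 - (1 / 4) *
        ∑' k : ℕ, ((1 / Real.sinh ((k + 1) * r) ^ 2 : ℝ) : ℂ) := by
  exact ⟨(wzeta_final r hr).trans (theta_final hr).2.symm, wzeta_final r hr⟩
end
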